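/- Let Φ = (φ_e)_{e∈E} be an irreducible compact similarity IFS on ℝ^d, and let μ be a Borel probability measure on E with supp μ = E which is contracting on average. Then π_*β(BA) = 0, where β = μ^{⊗ℕ} and π : E^ℕ → ℝ^d is the β-almost everywhere defined coding map; that is, β({b ∈ E^ℕ : the limit π(b) exists and π(b) ∈ BA}) = 0. -/

import Mathlib

open MeasureTheory Filter Topology

noncomputable section

def IrreducibleIFS {E : Type*} {d : ℕ}
    (φ : E → EuclideanSpace ℝ (Fin d) → EuclideanSpace ℝ (Fin d)) : Prop :=
  ¬ ∃ L : AffineSubspace ℝ (EuclideanSpace ℝ (Fin d)),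
      (L : Set (EuclideanSpace ℝ (Fin d))).Nonempty ∧ L ≠ ⊤ ∧
        ∀ e, φ e '' (L : Set (EuclideanSpace ℝ (Fin d))) = (L : Set (EuclideanSpace ℝ (Fin d)))

def seqApply {E X : Type*} (φ : E → X → X) (b : ℕ → E) : ℕ → X → X
  | 0 => id
  | n + 1 => fun x => seqApply φ b n (φ (b n) x)

/-- `β` is the Bernoulli measure `μ^{⊗ℕ}` on `E^ℕ`. -/
def IsBernoulli {E : Type*} [MeasurableSpace E] (μ : Measure E) (β : Measure (ℕ → E)) : Prop :=
  IsProbabilityMeasure β ∧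
    ∀ (F : Finset ℕ) (s : ℕ → Set E), (∀ i ∈ F, MeasurableSet (s i)) →
      β {b | ∀ i ∈ F, b i ∈ s i} = ∏ i ∈ F, μ (s i)

def badlyApproximable (d : ℕ) : Set (EuclideanSpace ℝ (Fin d)) :=
  {α | ∃ c : ℝ, 0 < c ∧ ∀ q : ℕ, 0 < q → ∀ p : Fin d → ℤ,
    c * (q : ℝ) ^ (-(1 : ℝ) / d) ≤
      ‖(q : ℝ) • α - (EuclideanSpace.equiv (Fin d) ℝ).symm (fun i => (p i : ℝ))‖}

set_option linter.unusedSectionVars false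
set_option linter.unusedVariables false

section PartOne
variable {F : Type*} [NormedAddCommGroup F] [InnerProductSpace ℝ F] [FiniteDimensional ℝ F]

def G1 (C0 : ℝ) (Λ : AddSubgroup (F × ℝ)) : Prop :=
  ∀ M : (F × ℝ) →ₗ[ℝ] (F × ℝ), |LinearMap.det M| = 1 → ∃ v ∈ Λ, v ≠ 0 ∧ ‖M v‖ ≤ C0

def G2 (Λ : AddSubgroup (F × ℝ)) : Prop := ∀ v ∈ Λ, v.2 = 0 → v = 0

def Good (C0 : ℝ) (Λ : AddSubgroup (F × ℝ)) : Prop := G1 C0 Λ ∧ G2 Λ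

def NN (d : ℕ) (c : ℝ) (Λ : AddSubgroup (F × ℝ)) : Set F :=
  {ξ | ∀ v ∈ Λ, v.2 ≠ 0 → c ≤ |v.2| * ‖v.1 - v.2 • ξ‖ ^ d}

def Simil (s : ℝ) (O : F →L[ℝ] F) : Prop := 0 < s ∧ ∀ x, ‖O x‖ = s * ‖x‖

theorem Simil.one : Simil 1 (1 : F →L[ℝ] F) := ⟨one_pos, fun x => by simp⟩

theorem Simil.mul {s t : ℝ} {O P : F →L[ℝ] F} (h : Simil s O) (k : Simil t P) :
    Simil (s * t) (O * P) :=
  ⟨mul_pos h.1 k.1, fun x => by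
    rw [mul_apply_eq_comp, h.2, k.2, mul_assoc]⟩

theorem Simil.pow {s : ℝ} {O : F →L[ℝ] F} (h : Simil s O) (n : ℕ) : Simil (s ^ n) (O ^ n) := by
  induction n with
  | zero => simpa using Simil.one
  | succ n ih => rw [pow_succ, pow_succ]; exact ih.mul h

theorem Simil.norm_le {s : ℝ} {O : F →L[ℝ] F} (h : Simil s O) : ‖O‖ ≤ s :=
  ContinuousLinearMap.opNorm_le_bound _ h.1.le (fun x => (h.2 x).le)

theorem Simil.exists_inv {s : ℝ} {O : F →L[ℝ] F} (h : Simil s O) :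
    ∃ P : F →L[ℝ] F, Simil s⁻¹ P ∧ O * P = 1 ∧ P * O = 1 := by
  have hinj : Function.Injective (O : F →ₗ[ℝ] F) := by
    rw [← LinearMap.ker_eq_bot, LinearMap.ker_eq_bot']
    intro m hm
    have h1 := h.2 m
    have h2 : O m = 0 := hm
    rw [h2, norm_zero] at h1
    have := h.1.ne'
    have h3 : ‖m‖ = 0 := by
      rcases mul_eq_zero.1 h1.symm with h4 | h4
      · exact absurd h4 this
      · exact h4
    simpa using h3
  let e := (LinearEquiv.ofInjectiveEndo (O : F →ₗ[ℝ] F) hinj).toContinuousLinearEquiv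
  have he : ∀ x, e x = O x := fun x => rfl
  refine ⟨e.symm, ⟨inv_pos.2 h.1, fun x => ?_⟩, ?_, ?_⟩
  · have h1 := h.2 (e.symm x)
    rw [← he, e.apply_symm_apply] at h1
    have := h.1.ne'
    change ‖e.symm x‖ = _
    rw [h1]; field_simp
  · ext x
    change O (e.symm x) = x
    rw [← he, e.apply_symm_apply]
  · ext x
    change e.symm (O x) = x
    rw [← he, e.symm_apply_apply]

theorem Simil.abs_det {s : ℝ} {O : F →L[ℝ] F} (h : Simil s O) :
    |LinearMap.det (O : F →ₗ[ℝ] F)| = s ^ Module.finrank ℝ F := by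
  have hs := h.1.ne'
  let I : F →ₗᵢ[ℝ] F := ⟨s⁻¹ • (O : F →ₗ[ℝ] F), fun x => by
    change ‖s⁻¹ • O x‖ = ‖x‖
    rw [norm_smul, h.2, norm_inv, Real.norm_of_nonneg h.1.le]; field_simp⟩
  have h1 : (O : F →ₗ[ℝ] F) = s • I.toLinearMap := by
    ext x
    change O x = s • (s⁻¹ • O x)
    rw [smul_smul, mul_inv_cancel₀ hs, one_smul]
  have h2 := I.normDet_eq_one
  rw [LinearMap.normDet_eq_norm_det, Real.norm_eq_abs] at h2
  rw [h1, LinearMap.det_smul, abs_mul, h2, mul_one, abs_of_pos (pow_pos h.1 _)]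

/-- The linear map `(p, q) ↦ (lam • (O p + q • y), lam * q)`. -/
def actM (lam : ℝ) (O : F →L[ℝ] F) (y : F) : (F × ℝ) →ₗ[ℝ] (F × ℝ) :=
  lam • ((LinearMap.transvection (LinearMap.snd ℝ F ℝ) (y, (0:ℝ))) ∘ₗ
    (LinearMap.prodMap (O : F →ₗ[ℝ] F) LinearMap.id))

theorem actM_apply (lam : ℝ) (O : F →L[ℝ] F) (y : F) (v : F × ℝ) :
    actM lam O y v = (lam • (O v.1 + v.2 • y), lam * v.2) := by
  ext <;> simp [actM, LinearMap.transvection]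

theorem actM_det {d : ℕ} (hd : Module.finrank ℝ F = d) {s lam : ℝ} {O : F →L[ℝ] F}
    (h : Simil s O) (hl : 0 < lam) (hls : lam ^ (d + 1) * s ^ d = 1) (y : F) :
    |LinearMap.det (actM lam O y)| = 1 := by
  rw [actM, LinearMap.det_smul, LinearMap.det_comp, LinearMap.transvection.det,
    LinearMap.det_prodMap]
  simp only [Module.finrank_prod, Module.finrank_self, hd, LinearMap.snd_apply, add_zero, one_mul,
    LinearMap.det_id, mul_one]
  rw [abs_mul, h.abs_det, hd, abs_of_pos (pow_pos hl _), hls]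

def lamOf (d : ℕ) (s : ℝ) : ℝ := (s ^ d) ^ (-(1 : ℝ) / (d + 1))

theorem lamOf_pos (d : ℕ) {s : ℝ} (hs : 0 < s) : 0 < lamOf d s :=
  Real.rpow_pos_of_pos (pow_pos hs _) _

theorem lamOf_spec (d : ℕ) {s : ℝ} (hs : 0 < s) : lamOf d s ^ (d + 1) * s ^ d = 1 := by
  have h := pow_pos hs d
  rw [lamOf, ← Real.rpow_natCast, ← Real.rpow_mul h.le]
  have : -(1:ℝ) / (d + 1) * ((d + 1 : ℕ) : ℝ) = -1 := by push_cast; field_simp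
  rw [this, Real.rpow_neg_one, inv_mul_cancel₀ h.ne']

theorem lamOf_one (d : ℕ) : lamOf d 1 = 1 := by simp [lamOf]

/-- The lattice obtained by applying the action of `x ↦ O x + y`. -/
def act (d : ℕ) (s : ℝ) (O : F →L[ℝ] F) (y : F) (Λ : AddSubgroup (F × ℝ)) :
    AddSubgroup (F × ℝ) := Λ.map (actM (lamOf d s) O y).toAddMonoidHom

theorem mem_act {d : ℕ} {s : ℝ} {O : F →L[ℝ] F} {y : F} {Λ : AddSubgroup (F × ℝ)} {w : F × ℝ} :
    w ∈ act d s O y Λ ↔ ∃ v ∈ Λ, (lamOf d s • (O v.1 + v.2 • y), lamOf d s * v.2) = w := by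
  simp only [act, AddSubgroup.mem_map]
  simp only [LinearMap.toAddMonoidHom_coe, actM_apply]

theorem act_G1 {d : ℕ} (hd : Module.finrank ℝ F = d) {s : ℝ} {O : F →L[ℝ] F}
    (h : Simil s O) (y : F) {C0 : ℝ} {Λ : AddSubgroup (F × ℝ)} (hΛ : G1 C0 Λ) :
    G1 C0 (act d s O y Λ) := by
  intro M hM
  have hl := lamOf_pos d h.1
  obtain ⟨v, hv, hv0, hvM⟩ := hΛ (M ∘ₗ actM (lamOf d s) O y) (by
    rw [LinearMap.det_comp, abs_mul, hM, actM_det hd h hl (lamOf_spec d h.1), one_mul])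
  refine ⟨actM (lamOf d s) O y v, ⟨v, hv, rfl⟩, ?_, hvM⟩
  intro h0
  have hdet := actM_det hd h hl (lamOf_spec d h.1) y
  have hdet' : LinearMap.det (actM (lamOf d s) O y) ≠ 0 := by
    intro h; rw [h] at hdet; simp at hdet
  have : Function.Injective (actM (lamOf d s) O y) :=
    (LinearMap.equivOfDetNeZero _ hdet').injective
  exact hv0 (this (by rw [h0, map_zero]))

theorem act_G2 {d : ℕ} {s : ℝ} {O : F →L[ℝ] F}
    (h : Simil s O) (y : F) {Λ : AddSubgroup (F × ℝ)} (hΛ : G2 Λ) :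
    G2 (act d s O y Λ) := by
  intro w hw hw0
  obtain ⟨v, hv, rfl⟩ := mem_act.1 hw
  have hl := lamOf_pos d h.1
  have : v = 0 := hΛ v hv (by
    rcases mul_eq_zero.1 hw0 with h | h
    · exact absurd h hl.ne'
    · exact h)
  subst this; simp

theorem act_good {d : ℕ} (hd : Module.finrank ℝ F = d) {s : ℝ} {O : F →L[ℝ] F}
    (h : Simil s O) (y : F) {C0 : ℝ} {Λ : AddSubgroup (F × ℝ)} (hΛ : Good C0 Λ) :
    Good C0 (act d s O y Λ) := ⟨act_G1 hd h y hΛ.1, act_G2 h y hΛ.2⟩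

theorem act_NN {d : ℕ} {s : ℝ} {O : F →L[ℝ] F}
    (h : Simil s O) (y : F) {c : ℝ} {Λ : AddSubgroup (F × ℝ)} {ξ : F} (hξ : ξ ∈ NN d c Λ) :
    O ξ + y ∈ NN d c (act d s O y Λ) := by
  intro w hw hw0
  obtain ⟨v, hv, rfl⟩ := mem_act.1 hw
  have hl := lamOf_pos d h.1
  have hv0 : v.2 ≠ 0 := by
    intro h; apply hw0; simp [h]
  refine (hξ v hv hv0).trans (le_of_eq ?_)
  have h1 : lamOf d s • (O v.1 + v.2 • y) - (lamOf d s * v.2) • (O ξ + y)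
      = lamOf d s • O (v.1 - v.2 • ξ) := by
    rw [map_sub, map_smul, mul_smul]; module
  simp only [h1]
  rw [norm_smul, h.2, Real.norm_of_nonneg hl.le, abs_mul, abs_of_pos hl, mul_pow, mul_pow]
  have := lamOf_spec d h.1
  rw [pow_succ] at this
  calc _ = (lamOf d s ^ d * lamOf d s * s ^ d) * (|v.2| * ‖v.1 - v.2 • ξ‖ ^ d) := by
        rw [this, one_mul]
    _ = _ := by ring

theorem NN_short {d : ℕ} {c : ℝ} {Λ : AddSubgroup (F × ℝ)} {ξ : F}
    (hξ : ξ ∈ NN d c Λ) {v : F × ℝ} (hv : v ∈ Λ) (hv0 : v.2 ≠ 0) :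
    min 1 (c / (1 + ‖ξ‖) ^ d) ≤ ‖v‖ := by
  by_contra! hlt
  have h1 : ‖v‖ < 1 := lt_of_lt_of_le hlt (min_le_left _ _)
  have h2 : ‖v‖ < c / (1 + ‖ξ‖) ^ d := lt_of_lt_of_le hlt (min_le_right _ _)
  have h3 := hξ v hv hv0
  have h4 : |v.2| ≤ ‖v‖ := norm_snd_le v
  have h5 : ‖v.1 - v.2 • ξ‖ ≤ 1 + ‖ξ‖ := by
    refine (norm_sub_le _ _).trans ?_
    rw [norm_smul]
    have : ‖v.1‖ ≤ ‖v‖ := norm_fst_le v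
    have : ‖v.2‖ ≤ ‖v‖ := norm_snd_le v
    have : ‖v.2‖ * ‖ξ‖ ≤ 1 * ‖ξ‖ := by gcongr; linarith
    linarith
  have hp : 0 < (1 + ‖ξ‖) ^ d := by positivity
  rw [lt_div_iff₀ hp] at h2
  have : |v.2| * ‖v.1 - v.2 • ξ‖ ^ d ≤ ‖v‖ * (1 + ‖ξ‖) ^ d := by gcongr
  linarith

theorem ulim {ι X : Type*} [NormedAddCommGroup X] [ProperSpace X] (𝒲 : Ultrafilter ι)
    (f : ι → X) (R : ℝ) (h : ∀ᶠ k in (𝒲 : Filter ι), ‖f k‖ ≤ R) :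
    ∃ x, Tendsto f 𝒲 (𝓝 x) := by
  have hc : IsCompact (Metric.closedBall (0:X) R) := isCompact_closedBall 0 R
  obtain ⟨x, _, hx⟩ := hc.ultrafilter_le_nhds' (𝒲.map f) (by
    rw [Ultrafilter.mem_map]
    filter_upwards [h] with k hk
    simpa using hk)
  exact ⟨x, hx⟩

def Lim {ι : Type*} (𝒲 : Filter ι) (Λ : ι → AddSubgroup (F × ℝ)) : AddSubgroup (F × ℝ) where
  carrier := {v | ∃ f : ι → F × ℝ, (∀ k, f k ∈ Λ k) ∧ Tendsto f 𝒲 (𝓝 v)}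
  zero_mem' := ⟨fun _ => 0, fun k => (Λ k).zero_mem, tendsto_const_nhds⟩
  add_mem' := by
    rintro a b ⟨f, hf, hfa⟩ ⟨g, hg, hgb⟩
    exact ⟨fun k => f k + g k, fun k => (Λ k).add_mem (hf k) (hg k), hfa.add hgb⟩
  neg_mem' := by
    rintro a ⟨f, hf, hfa⟩
    exact ⟨fun k => - f k, fun k => (Λ k).neg_mem (hf k), hfa.neg⟩

theorem mem_Lim {ι : Type*} {𝒲 : Filter ι} {Λ : ι → AddSubgroup (F × ℝ)} {v : F × ℝ} :
    v ∈ Lim 𝒲 Λ ↔ ∃ f : ι → F × ℝ, (∀ k, f k ∈ Λ k) ∧ Tendsto f 𝒲 (𝓝 v) := Iff.rfl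

def WeakG2 {ι : Type*} (𝒲 : Filter ι) (Λ : ι → AddSubgroup (F × ℝ)) : Prop :=
  ∀ R : ℝ, ∀ᶠ k in 𝒲, ∀ v ∈ Λ k, v.2 = 0 → ‖v‖ ≤ R → v = 0

def NearNN {ι : Type*} (d : ℕ) (c : ℝ) (𝒲 : Filter ι) (Λ : ι → AddSubgroup (F × ℝ)) (ξ : F) :
    Prop := ∀ ε > 0, ∀ᶠ k in 𝒲, ∃ ξ' ∈ NN d c (Λ k), ‖ξ' - ξ‖ < ε

theorem lim_NN {ι : Type*} {d : ℕ} {c : ℝ} (𝒲 : Filter ι) [𝒲.NeBot]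
    (Λ : ι → AddSubgroup (F × ℝ)) {ξ : F}
    (h : NearNN d c 𝒲 Λ ξ) : ξ ∈ NN d c (Lim 𝒲 Λ) := by
  rintro v ⟨f, hf, hfv⟩ hv0
  by_contra! hlt
  have hcont : Continuous fun z : (F × ℝ) × F => |z.1.2| * ‖z.1.1 - z.1.2 • z.2‖ ^ d := by
    fun_prop
  have hev := hcont.continuousAt.eventually_lt (x₀ := (v, ξ)) continuousAt_const hlt
  rw [nhds_prod_eq] at hev
  obtain ⟨pa, hpa, pb, hpb, hab⟩ := Filter.eventually_prod_iff.1 hev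
  obtain ⟨ε, hε, hball⟩ := Metric.eventually_nhds_iff.1 hpb
  have hne : ∀ᶠ k in 𝒲, (f k).2 ≠ 0 :=
    ((continuous_snd.tendsto v).comp hfv).eventually_ne hv0
  obtain ⟨k, hk1, ⟨ξ', hξ', hk2⟩, hk3⟩ := ((hfv.eventually hpa).and ((h ε hε).and hne)).exists
  have h1 := hab hk1 (hball (by rwa [dist_eq_norm]))
  have h2 := hξ' (f k) (hf k) hk3
  simp only at h1
  linarith

theorem lim_good {ι : Type*} {d : ℕ} {c C0 : ℝ} (hc : 0 < c) (𝒲 : Ultrafilter ι)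
    (Λ : ι → AddSubgroup (F × ℝ)) {ξ : F} (h1 : ∀ k, G1 C0 (Λ k))
    (h2 : WeakG2 (𝒲 : Filter ι) Λ)
    (h : NearNN d c (𝒲 : Filter ι) Λ ξ) : Good C0 (Lim (𝒲 : Filter ι) Λ) := by
  constructor
  · intro M hM
    have hdet' : LinearMap.det M ≠ 0 := by
      intro h; rw [h] at hM; simp at hM
    let e := (LinearMap.equivOfDetNeZero M hdet').toContinuousLinearEquiv
    have he : ∀ x, e x = M x := fun x => rfl
    choose f hf hf0 hfM using fun k => h1 k M hM
    obtain ⟨v, hv⟩ := ulim 𝒲 f (‖(e.symm : (F × ℝ) →L[ℝ] (F × ℝ))‖ * C0)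
      (Eventually.of_forall fun k => by
        have := (e.symm : (F × ℝ) →L[ℝ] (F × ℝ)).le_opNorm (M (f k))
        rw [← he] at this
        simp only [ContinuousLinearEquiv.coe_coe, e.symm_apply_apply] at this
        refine this.trans ?_
        rw [he]
        gcongr
        exact hfM k)
    refine ⟨v, ⟨f, hf, hv⟩, ?_, ?_⟩
    · set ε := min 1 (c / (1 + (‖ξ‖ + 1)) ^ d) with hε
      have hεpos : 0 < ε := lt_min one_pos (by positivity)
      have hev : ∀ᶠ k in (𝒲 : Filter ι), ε ≤ ‖f k‖ := by
        filter_upwards [h 1 one_pos, h2 1] with k ⟨ξ', hξ', hk⟩ hk2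
        by_cases hq : (f k).2 = 0
        · by_contra! hlt
          exact hf0 k (hk2 _ (hf k) hq (hlt.le.trans (min_le_left _ _)))
        · refine le_trans ?_ (NN_short hξ' (hf k) hq)
          have : ‖ξ'‖ ≤ ‖ξ‖ + 1 := by
            have := norm_sub_norm_le ξ' ξ
            linarith
          rw [hε]
          gcongr
      have := ge_of_tendsto hv.norm hev
      intro h0
      rw [h0, norm_zero] at this
      linarith
    · have hMc : Continuous M := M.continuous_of_finiteDimensional
      exact le_of_tendsto ((hMc.tendsto v).comp hv).norm (Eventually.of_forall hfM)
  · rintro v ⟨f, hf, hfv⟩ hv0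
    by_contra hne
    have e1 : ∀ᶠ k in (𝒲 : Filter ι), f k ≠ 0 := hfv.eventually_ne hne
    have e2 : ∀ᶠ k in (𝒲 : Filter ι), ‖f k‖ < ‖v‖ + 1 :=
      hfv.norm.eventually_lt_const (by linarith)
    have e3 : Tendsto (fun k => |(f k).2| * (‖v‖ + 1 + (‖v‖ + 1) * (‖ξ‖ + 1)) ^ d)
        (𝒲 : Filter ι) (𝓝 0) := by
      have := ((continuous_snd.tendsto v).comp hfv).abs
      rw [hv0] at this
      simpa using this.mul_const ((‖v‖ + 1 + (‖v‖ + 1) * (‖ξ‖ + 1)) ^ d)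
    obtain ⟨k, hk1, hk2, hk3, ⟨ξ', hξ', hk4⟩, hk5⟩ := (e1.and (e2.and ((e3.eventually_lt_const hc).and
      ((h 1 one_pos).and (h2 (‖v‖ + 1)))))).exists
    have hq : (f k).2 ≠ 0 := fun hq => hk1 (hk5 _ (hf k) hq hk2.le)
    have h5 := hξ' (f k) (hf k) hq
    have h6 : ‖(f k).1 - (f k).2 • ξ'‖ ≤ ‖v‖ + 1 + (‖v‖ + 1) * (‖ξ‖ + 1) := by
      refine (norm_sub_le _ _).trans ?_
      rw [norm_smul]
      have a1 : ‖(f k).1‖ ≤ ‖f k‖ := norm_fst_le _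
      have a2 : ‖(f k).2‖ ≤ ‖f k‖ := norm_snd_le _
      have a3 : ‖ξ'‖ ≤ ‖ξ‖ + 1 := by
        have := norm_sub_norm_le ξ' ξ
        linarith
      gcongr <;> linarith
    have : |(f k).2| * ‖(f k).1 - (f k).2 • ξ'‖ ^ d ≤
      |(f k).2| * (‖v‖ + 1 + (‖v‖ + 1) * (‖ξ‖ + 1)) ^ d := by gcongr
    linarith

theorem weakG2_of_G2 {ι : Type*} (𝒲 : Filter ι) {Λ : ι → AddSubgroup (F × ℝ)}
    (h : ∀ k, G2 (Λ k)) : WeakG2 𝒲 Λ :=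
  fun _ => Eventually.of_forall fun k v hv h0 _ => h k v hv h0

theorem nearNN_of_mem {ι : Type*} {d : ℕ} {c : ℝ} (𝒲 : Filter ι)
    {Λ : ι → AddSubgroup (F × ℝ)} {ξ : F} (h : ∀ᶠ k in 𝒲, ξ ∈ NN d c (Λ k)) :
    NearNN d c 𝒲 Λ ξ := fun ε hε => by
  filter_upwards [h] with k hk
  exact ⟨ξ, hk, by simpa using hε⟩

theorem nearNN_of_tendsto {ι : Type*} {d : ℕ} {c : ℝ} {𝒲 : Filter ι}
    {Λ : ι → AddSubgroup (F × ℝ)} {ξ : F} {f : ι → F} (hf : Tendsto f 𝒲 (𝓝 ξ))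
    (h : ∀ᶠ k in 𝒲, f k ∈ NN d c (Λ k)) :
    NearNN d c 𝒲 Λ ξ := fun ε hε => by
  filter_upwards [h, Metric.tendsto_nhds.1 hf ε hε] with k hk hk2
  exact ⟨f k, hk, by rwa [dist_eq_norm] at hk2⟩

end PartOne

theorem clm_apply_tendsto {ι X Y : Type*} [NormedAddCommGroup X] [NormedSpace ℝ X]
    [NormedAddCommGroup Y] [NormedSpace ℝ Y]
    {l : Filter ι} {f : ι → X →L[ℝ] Y} {g : X →L[ℝ] Y} {x : ι → X} {y : X}
    (hf : Tendsto f l (𝓝 g)) (hx : Tendsto x l (𝓝 y)) :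
    Tendsto (fun k => f k (x k)) l (𝓝 (g y)) :=
  ((isBoundedBilinearMap_apply (𝕜 := ℝ) (E := X) (F := Y)).continuous.tendsto (g, y)).comp
    (hf.prodMk_nhds hx)

theorem clm_mul_tendsto {ι X : Type*} [NormedAddCommGroup X] [NormedSpace ℝ X]
    {l : Filter ι} {f f' : ι → X →L[ℝ] X} {g g' : X →L[ℝ] X}
    (hf : Tendsto f l (𝓝 g)) (hf' : Tendsto f' l (𝓝 g')) :
    Tendsto (fun k => f k * f' k) l (𝓝 (g * g')) :=
  ((isBoundedBilinearMap_comp (𝕜 := ℝ) (E := X) (F := X) (G := X)).continuous.tendsto (g, g')).comp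
    (hf.prodMk_nhds hf')

theorem clm_norm_tendsto {ι X Y : Type*} [NormedAddCommGroup X] [NormedSpace ℝ X]
    [NormedAddCommGroup Y] [NormedSpace ℝ Y]
    {l : Filter ι} {f : ι → X →L[ℝ] Y} {g : X →L[ℝ] Y} 
    (hf : Tendsto f l (𝓝 g)) :
    Tendsto (fun k => ‖f k - g‖) l (𝓝 0) :=
  (tendsto_iff_norm_sub_tendsto_zero (E := X →L[ℝ] Y)).1 hf

section PartTwo
variable {F : Type*} [NormedAddCommGroup F] [InnerProductSpace ℝ F] [FiniteDimensional ℝ F]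

theorem good_short {d : ℕ} {c C0 : ℝ} {Λ : AddSubgroup (F × ℝ)} (hg : Good C0 Λ)
    (h0 : (0 : F) ∈ NN d c Λ) {v : F × ℝ} (hv : v ∈ Λ) (hv0 : v ≠ 0) : min 1 c ≤ ‖v‖ := by
  have := NN_short h0 hv (fun h => hv0 (hg.2 v hv h))
  simpa using this

theorem good_span {d : ℕ} (hd : Module.finrank ℝ F = d) {c C0 : ℝ} (hc : 0 < c)
    {Λ : AddSubgroup (F × ℝ)} (hg : Good C0 Λ)
    (h0 : (0 : F) ∈ NN d c Λ) : Submodule.span ℝ (Λ : Set (F × ℝ)) = ⊤ := by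
  by_contra hne
  obtain ⟨f, hf0, hf⟩ := Submodule.exists_le_ker_of_lt_top _ (lt_top_iff_ne_top.2 hne)
  obtain ⟨e, he⟩ : ∃ e, f e = 1 := by
    obtain ⟨x, hx⟩ : ∃ x, f x ≠ 0 := by
      by_contra! h
      exact hf0 (LinearMap.ext h)
    exact ⟨(f x)⁻¹ • x, by simp [hx]⟩
  have hε : 0 < min 1 c := lt_min one_pos hc
  obtain ⟨lam, hlam, hlam1⟩ : ∃ lam : ℝ, 0 < lam ∧ C0 < lam * min 1 c := by
    refine ⟨(|C0| + 1) / min 1 c, by positivity, ?_⟩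
    rw [div_mul_cancel₀ _ hε.ne']
    linarith [le_abs_self C0]
  have hM : |LinearMap.det (lam • LinearMap.transvection f (((lam ^ (d + 1))⁻¹ - 1) • e))| = 1 := by
    rw [LinearMap.det_smul, LinearMap.transvection.det]
    simp only [Module.finrank_prod, Module.finrank_self, hd, map_smul, he, smul_eq_mul, mul_one,
      add_sub_cancel]
    rw [mul_inv_cancel₀ (pow_pos hlam _).ne', abs_one]
  obtain ⟨v, hv, hv0, hvM⟩ := hg.1 _ hM
  have hfv : f v = 0 := hf (Submodule.subset_span hv)
  have h1 := good_short hg h0 hv hv0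
  simp only [LinearMap.smul_apply, LinearMap.transvection.apply, hfv, zero_smul, add_zero,
    norm_smul, Real.norm_of_nonneg hlam.le] at hvM
  have : lam * min 1 c ≤ lam * ‖v‖ := by gcongr
  linarith

theorem good_basis {d : ℕ} (hd : Module.finrank ℝ F = d) {c C0 : ℝ} (hc : 0 < c)
    {Λ : AddSubgroup (F × ℝ)} (hg : Good C0 Λ)
    (h0 : (0 : F) ∈ NN d c Λ) : ∃ (n : ℕ) (B : Module.Basis (Fin n) ℝ (F × ℝ)),
      ∀ v, v ∈ Λ ↔ v ∈ Submodule.span ℤ (Set.range B) := by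
  have hε : 0 < min 1 c := lt_min one_pos hc
  let L : Submodule ℤ (F × ℝ) := AddSubgroup.toIntSubmodule Λ
  have hL : ∀ v, v ∈ L ↔ v ∈ Λ := fun v => Iff.rfl
  have hdisc : DiscreteTopology L := by
    apply discreteTopology_of_isOpen_singleton_zero
    have : ({0} : Set L) = (Subtype.val) ⁻¹' (Metric.ball (0 : F × ℝ) (min 1 c)) := by
      ext x
      simp only [Set.mem_singleton_iff, Set.mem_preimage, Metric.mem_ball, dist_zero_right]
      constructor
      · rintro rfl; simpa using hc
      · intro h
        by_contra hx
        have := good_short hg h0 (v := x.1) x.2 (fun h => hx (Subtype.ext h))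
        linarith
    rw [this]
    exact Metric.isOpen_ball.preimage continuous_subtype_val
  have hz : IsZLattice ℝ L := ⟨good_span hd hc hg h0⟩
  have : Module.Finite ℤ L := ZLattice.module_finite ℝ L
  have : Module.Free ℤ L := ZLattice.module_free ℝ L
  let b := Module.Free.chooseBasis ℤ L
  let b' := b.reindex (Fintype.equivFin _)
  refine ⟨_, b'.ofZLatticeBasis ℝ L, fun v => ?_⟩
  rw [Module.Basis.ofZLatticeBasis_span ℝ L b']
  exact (hL v).symm

theorem basis_stab {d : ℕ} (hd : Module.finrank ℝ F = d) {c C0 : ℝ} (hc : 0 < c)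
    (Λ : ℕ → AddSubgroup (F × ℝ)) (hg : ∀ m, Good C0 (Λ m))
    (h0 : ∀ m, (0 : F) ∈ NN d c (Λ m)) (𝒱 : Ultrafilter ℕ) {δ : ℝ} (hδ : 0 < δ) :
    ∃ A ∈ 𝒱, ∀ m ∈ A, ∀ l ∈ A, ∃ g : (F × ℝ) →L[ℝ] (F × ℝ), ‖g - 1‖ ≤ δ ∧
      ∀ v ∈ Λ m, g v ∈ Λ l := by
  have hnear : NearNN d c (𝒱 : Filter ℕ) Λ 0 := nearNN_of_mem _ (Eventually.of_forall h0)
  have hL := lim_good hc 𝒱 Λ (fun k => (hg k).1) (weakG2_of_G2 _ fun k => (hg k).2) hnear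
  have hL0 := lim_NN _ Λ hnear
  set L := Lim (𝒱 : Filter ℕ) Λ with hLdef
  obtain ⟨n, B, hB⟩ := good_basis hd hc hL hL0
  have hBL : ∀ i, ∃ f : ℕ → F × ℝ, (∀ k, f k ∈ Λ k) ∧ Tendsto f 𝒱 (𝓝 (B i)) := fun i =>
    mem_Lim.1 ((hB _).2 (Submodule.subset_span ⟨i, rfl⟩))
  choose fB hfB hfBt using hBL
  let co : Fin n → (F × ℝ) →L[ℝ] ℝ := fun i => LinearMap.toContinuousLinearMap (B.coord i)
  let e : ℕ → (F × ℝ) →L[ℝ] (F × ℝ) := fun m => ∑ i, ContinuousLinearMap.smulRight (co i) (fB i m)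
  have heB : ∀ m i, e m (B i) = fB i m := by
    intro m i
    simp only [e, sum_apply, ContinuousLinearMap.smulRight_apply, co,
      LinearMap.coe_toContinuousLinearMap', Module.Basis.coord_apply, Module.Basis.repr_self]
    rw [Finset.sum_eq_single i]
    · simp
    · intro j _ hj
      simp [hj.symm]
    · simp
  have he1 : Tendsto e 𝒱 (𝓝 1) := by
    have h1 : (1 : (F × ℝ) →L[ℝ] (F × ℝ)) = ∑ i, ContinuousLinearMap.smulRight (co i) (B i) := by
      refine ContinuousLinearMap.ext fun x => ?_
      rw [sum_apply]
      simp only [ContinuousLinearMap.smulRight_apply, co,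
        LinearMap.coe_toContinuousLinearMap', Module.Basis.coord_apply]
      rw [B.sum_repr]; rfl
    rw [h1]
    refine tendsto_finsetSum _ fun i _ => ?_
    exact (((ContinuousLinearMap.smulRightL ℝ (F × ℝ) (F × ℝ) (co i)).continuous.tendsto _).comp
      (hfBt i))
  have heL : ∀ m, ∀ u ∈ L, e m u ∈ Λ m := by
    intro m u hu
    have hu' := (hB u).1 hu
    induction hu' using Submodule.span_induction with
    | mem x hx =>
      obtain ⟨i, rfl⟩ := hx
      rw [heB]; exact hfB i m
    | zero => rw [map_zero]; exact (Λ m).zero_mem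
    | add x y hx hy h1 h2 =>
      rw [map_add]
      exact (Λ m).add_mem (h1 ((hB _).2 hx)) (h2 ((hB _).2 hy))
    | smul a x hx h1 =>
      rw [map_zsmul]
      exact (Λ m).zsmul_mem (h1 ((hB _).2 hx)) a
  have hunit : ∀ᶠ m in (𝒱 : Filter ℕ), IsUnit (e m) :=
    he1.eventually (by
      have := Units.nhds (R := (F × ℝ) →L[ℝ] (F × ℝ)) 1
      rwa [Units.val_one] at this)
  have hclaim : ∀ᶠ m in (𝒱 : Filter ℕ), ∀ v ∈ Λ m, ∃ u ∈ L, e m u = v := by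
    by_contra hcon
    rw [← Ultrafilter.eventually_not] at hcon
    have hex : ∀ m, ∃ f : F × ℝ, e m f ∈ Λ m ∧ ‖f‖ ≤ ∑ i, ‖B i‖ ∧
        (¬ (∀ v ∈ Λ m, ∃ u ∈ L, e m u = v) → IsUnit (e m) → ∀ u ∈ L, e m u ≠ e m f) := by
      intro m
      by_cases h : (∀ v ∈ Λ m, ∃ u ∈ L, e m u = v) ∨ ¬ IsUnit (e m)
      · refine ⟨0, by rw [map_zero]; exact (Λ m).zero_mem, ?_, ?_⟩
        · rw [norm_zero]; positivity
        · intro h1 h2; rcases h with h | h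
          · exact absurd h h1
          · exact absurd h2 h
      · push Not at h
        obtain ⟨⟨v, hv, hvu⟩, hu⟩ := h
        set w := Ring.inverse (e m) v with hw
        have hwv : e m w = v := by
          rw [hw, ← mul_apply_eq_comp, Ring.mul_inverse_cancel _ hu]; rfl
        have hfl : ((ZSpan.floor B w : F × ℝ)) ∈ L := (hB _).2 (ZSpan.floor B w).2
        refine ⟨ZSpan.fract B w, ?_, ZSpan.norm_fract_le B w, ?_⟩
        · rw [ZSpan.fract_apply, map_sub, hwv]
          exact (Λ m).sub_mem hv (heL m _ hfl)
        · intro _ _ u hu' heq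
          apply hvu (u + ZSpan.floor B w) (L.add_mem hu' hfl)
          rw [map_add, heq, ← map_add, ZSpan.fract_apply, sub_add_cancel, hwv]
    choose f hf1 hf2 hf3 using hex
    obtain ⟨fs, hfs⟩ := ulim 𝒱 f _ (Eventually.of_forall hf2)
    have hef : Tendsto (fun m => e m (f m)) 𝒱 (𝓝 fs) := by
      have := clm_apply_tendsto he1 hfs
      simpa using this
    have hfsL : fs ∈ L := ⟨_, hf1, hef⟩
    have hx : Tendsto (fun m => e m (f m) - e m fs) 𝒱 (𝓝 0) := by
      have := hef.sub (clm_apply_tendsto he1 (tendsto_const_nhds (x := fs)))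
      simpa using this
    have hε : 0 < min 1 c := lt_min one_pos hc
    have hsm := hx.norm.eventually_lt_const (u := min 1 c) (by simpa using hc)
    obtain ⟨m, hm1, hm2, hm3⟩ := (hcon.and (hunit.and hsm)).exists
    have hne := hf3 m hm1 hm2 fs hfsL
    have := good_short (hg m) (h0 m) ((Λ m).sub_mem (hf1 m) (heL m fs hfsL))
      (sub_ne_zero.2 hne.symm)
    linarith
  have hinv : Tendsto (fun z : ((F × ℝ) →L[ℝ] (F × ℝ)) × ((F × ℝ) →L[ℝ] (F × ℝ)) =>
      z.1 * Ring.inverse z.2) (𝓝 1 ×ˢ 𝓝 1) (𝓝 1) := by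
    have h1 : Tendsto (Ring.inverse : ((F × ℝ) →L[ℝ] (F × ℝ)) → _) (𝓝 1) (𝓝 1) := by
      have := NormedRing.inverse_continuousAt (R := (F × ℝ) →L[ℝ] (F × ℝ)) 1
      have h2 := this.tendsto
      simpa using h2
    have := clm_mul_tendsto (tendsto_fst (f := 𝓝 (1 : (F × ℝ) →L[ℝ] (F × ℝ))) (g := 𝓝 1))
      (h1.comp tendsto_snd)
    simpa using this
  have hball := (clm_norm_tendsto hinv).eventually_lt_const hδ
  obtain ⟨pa, hpa, pb, hpb, hab⟩ := Filter.eventually_prod_iff.1 hball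
  refine ⟨{m | (∀ v ∈ Λ m, ∃ u ∈ L, e m u = v) ∧ IsUnit (e m) ∧ pa (e m) ∧ pb (e m)}, ?_, ?_⟩
  · exact hclaim.and (hunit.and ((he1.eventually hpa).and (he1.eventually hpb)))
  · rintro m ⟨hm1, hm2, hm3, hm4⟩ l ⟨hl1, hl2, hl3, hl4⟩
    refine ⟨e l * Ring.inverse (e m), ?_, ?_⟩
    · have := hab hl3 hm4
      exact le_of_lt this
    · intro v hv
      obtain ⟨u, hu, rfl⟩ := hm1 v hv
      rw [mul_apply_eq_comp, ← mul_apply_eq_comp (Ring.inverse (e m)),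
        Ring.inverse_mul_cancel _ hm2]
      exact heL l u hu

end PartTwo

section PartThree
variable {F : Type*} [NormedAddCommGroup F] [InnerProductSpace ℝ F] [FiniteDimensional ℝ F]

theorem lemma_R {d : ℕ} (hd : Module.finrank ℝ F = d) {c C0 : ℝ} (hc : 0 < c) (hC0 : 0 < C0) :
    ∃ δ0 > 0, ∃ c1 > 0, ∀ (Λ Λ' : AddSubgroup (F × ℝ)) (G : F →L[ℝ] F) (t : F)
      (g : (F × ℝ) →L[ℝ] (F × ℝ)), Good C0 Λ → Good C0 Λ' → (0 : F) ∈ NN d c Λ →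
      (0 : F) ∈ NN d c Λ' → (∀ v ∈ Λ, (G v.1 - v.2 • t, v.2) ∈ Λ') → (∀ v ∈ Λ, g v ∈ Λ') →
      ‖G - 1‖ ≤ δ0 → ‖g - 1‖ ≤ δ0 → 1 ≤ ‖t‖ →
      ∀ r : ℝ, 0 ≤ r → (∀ p, |(g (p, 0)).2| ≤ r * ‖p‖) → c1 ≤ r * ‖t‖ := by
  set K : ℝ := 3 ^ d * C0 ^ (d + 1) with hK
  have hKpos : 0 < K := by positivity
  refine ⟨min 1 (c / (4 * K)), by positivity, c / (2 * K), by positivity, ?_⟩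
  intro Λ Λ' G t g hΛ hΛ' h0 h0' hk hgg hG hg1 ht r hr0 hr
  set δ := min 1 (c / (4 * K)) with hδ
  have hδpos : 0 < δ := by positivity
  have hδ1 : δ ≤ 1 := min_le_left _ _
  have hδ2 : δ * (4 * K) ≤ c := by
    rw [← le_div_iff₀ (by positivity)]; exact min_le_right _ _
  obtain ⟨P, hP1, hPt⟩ : ∃ P : ℝ, 1 ≤ P ∧ P ^ (d + 1) = ‖t‖ := by
    refine ⟨‖t‖ ^ ((1 : ℝ) / (d + 1)), Real.one_le_rpow ht (by positivity), ?_⟩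
    rw [← Real.rpow_natCast, ← Real.rpow_mul (norm_nonneg _)]
    have : (1:ℝ) / (d + 1) * ((d + 1 : ℕ) : ℝ) = 1 := by push_cast; field_simp
    rw [this, Real.rpow_one]
  have hP : 0 < P := by linarith
  have hPd : 0 < P ^ d := by positivity
  have hPd1 : 1 ≤ P ^ d := one_le_pow₀ hP1
  let M : (F × ℝ) →ₗ[ℝ] (F × ℝ) :=
    LinearMap.prodMap (P⁻¹ • LinearMap.id) ((P ^ d) • LinearMap.id)
  have hM : |LinearMap.det M| = 1 := by
    simp only [M]
    rw [LinearMap.det_prodMap, LinearMap.det_smul, LinearMap.det_smul, LinearMap.det_id,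
      LinearMap.det_id, hd, Module.finrank_self, pow_one, mul_one, mul_one, inv_pow,
      inv_mul_cancel₀ hPd.ne', abs_one]
  obtain ⟨v, hv, hv0, hvM⟩ := hΛ.1 M hM
  obtain ⟨p, q⟩ := v
  have hMv : M (p, q) = (P⁻¹ • p, P ^ d * q) := rfl
  rw [hMv] at hvM
  have hp : ‖p‖ ≤ C0 * P := by
    have := (norm_fst_le _).trans hvM
    simp only [norm_smul, norm_inv, Real.norm_of_nonneg hP.le] at this
    rwa [inv_mul_le_iff₀ hP, mul_comm] at this
  have hq : |q| * P ^ d ≤ C0 := by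
    have := (norm_snd_le _).trans hvM
    simp only [norm_mul, norm_pow, Real.norm_of_nonneg hP.le] at this
    rwa [mul_comm, Real.norm_eq_abs] at this
  have hq' : |q| ≤ C0 := by
    refine le_trans ?_ hq
    exact le_mul_of_one_le_right (abs_nonneg _) hPd1
  have hvn : ‖((p, q) : F × ℝ)‖ ≤ C0 * P := by
    rw [Prod.norm_mk]
    refine max_le hp (hq'.trans ?_)
    exact le_mul_of_one_le_right hC0.le hP1
  have hgv : ‖g (p, q) - (p, q)‖ ≤ δ * (C0 * P) := by
    have := (g - 1).le_opNorm (p, q)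
    calc _ = ‖(g - 1) (p, q)‖ := rfl
      _ ≤ _ := this
      _ ≤ _ := by gcongr
  have hgv1 : ‖(g (p, q)).1 - p‖ ≤ δ * (C0 * P) := (norm_fst_le (g (p, q) - (p, q))).trans hgv
  have hGp : ‖G p - p‖ ≤ δ * (C0 * P) := by
    have := (G - 1).le_opNorm p
    calc _ = ‖(G - 1) p‖ := rfl
      _ ≤ _ := this
      _ ≤ _ := by gcongr
  have hqt : ‖q • t‖ ≤ C0 * P := by
    rw [norm_smul, ← hPt, Real.norm_eq_abs, pow_succ, ← mul_assoc]
    gcongr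
  set x : F × ℝ := (G p - q • t, q) - g (p, q) with hx
  have hxΛ : x ∈ Λ' := Λ'.sub_mem (hk _ hv) (hgg _ hv)
  have hx1eq : x.1 = (G p - p) - q • t - ((g (p, q)).1 - p) := by
    simp only [hx, Prod.fst_sub]; abel
  have hx1 : ‖x.1‖ ≤ 3 * C0 * P := by
    rw [hx1eq]
    have a1 := norm_sub_le ((G p - p) - q • t) ((g (p, q)).1 - p)
    have a2 := norm_sub_le (G p - p) (q • t)
    have : δ * (C0 * P) ≤ 1 * (C0 * P) := by gcongr
    linarith
  have hx2 : |x.2| ≤ r * (C0 * P) + δ * |q| := by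
    have e1 : x.2 = q - (g (0, q)).2 - (g (p, 0)).2 := by
      have : g (p, q) = g (p, 0) + g (0, q) := by rw [← map_add]; simp
      simp only [hx, Prod.snd_sub, this, Prod.snd_add]; ring
    rw [e1]
    have a1 := abs_sub (q - (g (0, q)).2) (g (p, 0)).2
    have a2 : |q - (g (0, q)).2| ≤ δ * |q| := by
      have := (g - 1).le_opNorm (0, q)
      have h2 := (norm_snd_le ((g - 1) (0, q))).trans this
      have h3 : ((g - 1) (0, q)).2 = (g (0, q)).2 - q := rfl
      rw [h3, Real.norm_eq_abs, abs_sub_comm] at h2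
      refine h2.trans ?_
      have : ‖((0 : F), q)‖ = |q| := by simp [Prod.norm_mk]
      rw [this]; gcongr
    have a3 := hr p
    have a4 : r * ‖p‖ ≤ r * (C0 * P) := by gcongr
    linarith
  by_cases hx0 : x = 0
  · exfalso
    have hq0 : q ≠ 0 := fun h => hv0 (hΛ.2 _ hv h)
    have h1 := h0 _ hv hq0
    simp only [smul_zero, sub_zero] at h1
    have h2 : ‖q • t‖ ≤ 2 * δ * (C0 * P) := by
      have : q • t = (G p - p) - ((g (p, q)).1 - p) := by
        have h3 : x.1 = 0 := by rw [hx0]; rfl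
        rw [hx1eq] at h3
        rw [sub_right_comm] at h3
        exact (sub_eq_zero.1 h3).symm
      rw [this]
      have := norm_sub_le (G p - p) ((g (p, q)).1 - p)
      linarith
    rw [norm_smul, ← hPt, Real.norm_eq_abs, pow_succ, ← mul_assoc, ← mul_assoc] at h2
    have h3 : |q| * P ^ d ≤ 2 * δ * C0 := le_of_mul_le_mul_right h2 hP
    have h4 : |q| * ‖p‖ ^ d ≤ 2 * δ * C0 ^ (d + 1) := by
      calc |q| * ‖p‖ ^ d ≤ |q| * (C0 * P) ^ d := by gcongr
        _ = (|q| * P ^ d) * C0 ^ d := by rw [mul_pow]; ring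
        _ ≤ (2 * δ * C0) * C0 ^ d := by gcongr
        _ = _ := by ring
    have h5 : C0 ^ (d + 1) ≤ K := by
      rw [hK]
      exact le_mul_of_one_le_left (by positivity) (one_le_pow₀ (by norm_num))
    have h6 : 2 * δ * C0 ^ (d + 1) ≤ 2 * δ * K := by gcongr
    nlinarith
  · have hx20 : x.2 ≠ 0 := fun h => hx0 (hΛ'.2 _ hxΛ h)
    have h1 := h0' _ hxΛ hx20
    simp only [smul_zero, sub_zero] at h1
    have h2 : |x.2| * ‖x.1‖ ^ d ≤ K * (r * ‖t‖ + δ) := by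
      calc |x.2| * ‖x.1‖ ^ d ≤ (r * (C0 * P) + δ * |q|) * (3 * C0 * P) ^ d := by gcongr
        _ = 3 ^ d * C0 ^ (d + 1) * (r * P ^ (d + 1)) + 3 ^ d * C0 ^ d * δ * (|q| * P ^ d) := by
          rw [mul_pow, mul_pow]; ring
        _ ≤ 3 ^ d * C0 ^ (d + 1) * (r * P ^ (d + 1)) + 3 ^ d * C0 ^ d * δ * C0 := by gcongr
        _ = _ := by rw [hK, hPt]; ring
    rw [div_le_iff₀ (by positivity)]
    nlinarith

theorem exists_gap_ultrafilter : ∃ 𝒱 : Ultrafilter ℕ, ∀ A ∈ 𝒱, ∃ N : ℕ, ∀ K0 : ℕ,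
    ∃ m l, m < l ∧ l ≤ m + N ∧ K0 ≤ m ∧ m ∈ A ∧ l ∈ A := by
  letI : Add (Ultrafilter ℕ) := Ultrafilter.add
  let U : Ultrafilter ℕ := hyperfilter ℕ
  have hU : ∀ K : ℕ, ∀ᶠ m in (U : Filter ℕ), K ≤ m := by
    intro K
    have h1 : ((U : Filter ℕ)) ≤ atTop := by
      rw [← Nat.cofinite_eq_atTop]; exact hyperfilter_le_cofinite
    exact h1 (eventually_ge_atTop K)
  refine ⟨U + U, fun A hA => ?_⟩
  have hA' : ∀ᶠ m in ((U + U : Ultrafilter ℕ) : Filter ℕ), m ∈ A := hA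
  rw [Ultrafilter.eventually_add] at hA'
  obtain ⟨a, ha⟩ := hA'.exists
  obtain ⟨b, hb, hab⟩ := (hA'.and (hU (a + 1))).exists
  refine ⟨b - a, fun K0 => ?_⟩
  obtain ⟨m, h1, h2, h3⟩ := (ha.and (hb.and (hU K0))).exists
  exact ⟨a + m, b + m, by omega, by omega, by omega, h1, h2⟩

/-- Parameter space for quadratic maps `x ↦ b x x + l x + s`. -/
abbrev QM (F : Type*) [NormedAddCommGroup F] [InnerProductSpace ℝ F] :=
  (F →L[ℝ] F →L[ℝ] F) × (F →L[ℝ] F) × F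

def qev (x : F) : QM F →ₗ[ℝ] F where
  toFun q := q.1 x x + q.2.1 x + q.2.2
  map_add' a b := by simp; abel
  map_smul' a b := by simp [smul_add]

theorem qev_apply (x : F) (q : QM F) : qev x q = q.1 x x + q.2.1 x + q.2.2 := rfl

theorem quad_sep {T0 : Set F} {L : F →L[ℝ] F} {ρ : ℝ} (hL : Simil ρ L) (hρ : ρ < 1)
    (h0 : (0 : F) ∈ T0) (hLT : ∀ x ∈ T0, L x ∈ T0) (hspan : Submodule.span ℝ T0 = ⊤)
    (hT : ∀ y ∈ T0, ∃ (s : ℝ) (B : F →L[ℝ] F), Simil s B ∧ ∀ x ∈ T0, B x + y ∈ T0)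
    (q : QM F) (hq : ∀ x ∈ T0, qev x q = 0) (x : F) : qev x q = 0 := by
  obtain ⟨b, l, s⟩ := q
  simp only [qev_apply] at hq ⊢
  have hext : ∀ f : F →L[ℝ] F, (∀ x ∈ T0, f x = 0) → f = 0 := by
    intro f hf
    ext x
    have hx : x ∈ Submodule.span ℝ T0 := by rw [hspan]; trivial
    induction hx using Submodule.span_induction with
    | mem x hx => simpa using hf x hx
    | zero => simp
    | add x y _ _ h1 h2 => simp [h1, h2]
    | smul a x _ h => simp [h]
  have hρ0 := hL.1
  have hRn : ∀ n, Simil 1 ((ρ ^ n)⁻¹ • L ^ n) := fun n => ⟨one_pos, fun x => by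
    have := (hL.pow n).2 x
    rw [smul_apply, norm_smul, this, norm_inv,
      Real.norm_of_nonneg (pow_pos hρ0 n).le]
    field_simp⟩
  obtain ⟨R, hR⟩ := ulim (hyperfilter ℕ) (fun n => (ρ ^ n)⁻¹ • L ^ n) 1
    (Eventually.of_forall fun n => (hRn n).norm_le)
  have hRS : Simil 1 R := ⟨one_pos, fun x => by
    have := clm_apply_tendsto hR (tendsto_const_nhds (x := x))
    refine tendsto_nhds_unique this.norm ?_
    exact tendsto_const_nhds.congr (fun n => ((hRn n).2 x).symm)⟩
  have hLn : ∀ n, ∀ x ∈ T0, (L ^ n) x ∈ T0 := by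
    intro n
    induction n with
    | zero => intro x hx; simpa using hx
    | succ n ih => intro x hx; rw [pow_succ, mul_apply_eq_comp]; exact ih _ (hLT x hx)
  have hpow : Tendsto (fun n => ρ ^ n) (hyperfilter ℕ : Filter ℕ) (𝓝 0) :=
    (tendsto_pow_atTop_nhds_zero_of_lt_one hρ0.le hρ).mono_left
      (by rw [← Nat.cofinite_eq_atTop]; exact hyperfilter_le_cofinite)
  have hD : ∀ y ∈ T0, ∀ h, b y h + b h y + l h = 0 := by
    intro y hy
    obtain ⟨sB, B, hB, hBT⟩ := hT y hy
    let D : F →L[ℝ] F := b y + b.flip y + l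
    have hDa : ∀ h, D h = b y h + b h y + l h := fun h => rfl
    have hkey : ∀ n, ∀ x ∈ T0, D (B ((ρ ^ n)⁻¹ • (L ^ n) x)) =
        -(ρ ^ n • b (B ((ρ ^ n)⁻¹ • (L ^ n) x)) (B ((ρ ^ n)⁻¹ • (L ^ n) x))) := by
      intro n x hx
      have hne : ρ ^ n ≠ 0 := (pow_pos hρ0 n).ne'
      have h1 := hq _ (hBT _ (hLn n x hx))
      have h2 := hq _ hy
      set u := B ((L ^ n) x) with hu
      have h3 : D u = - b u u := by
        rw [hDa, eq_neg_iff_add_eq_zero]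
        have : b y u + b u y + l u + b u u =
          (b (u + y) (u + y) + l (u + y) + s) - (b y y + l y + s) := by
          simp only [map_add, add_apply]; abel
        rw [this, h1, h2, sub_zero]
      simp only [map_smul, smul_apply]
      rw [← hu, h3, smul_smul, smul_smul, smul_neg, mul_inv_cancel₀ hne, one_mul]
    have hDB : D * B * R = 0 := by
      apply hext
      intro x hx
      have t1 : Tendsto (fun n => (ρ ^ n)⁻¹ • (L ^ n) x) (hyperfilter ℕ : Filter ℕ) (𝓝 (R x)) :=
        clm_apply_tendsto hR (tendsto_const_nhds (x := x))
      have t2 := (B.continuous.tendsto _).comp t1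
      have t3 := (D.continuous.tendsto _).comp t2
      have t4 := clm_apply_tendsto ((b.continuous.tendsto _).comp t2) t2
      have t5 := (hpow.smul t4).neg
      rw [zero_smul, neg_zero] at t5
      exact tendsto_nhds_unique t3 (t5.congr fun n => (hkey n x hx).symm)
    obtain ⟨BR, _, hBR, _⟩ := (hB.mul hRS).exists_inv
    have : D = 0 := by
      calc D = D * (B * R * BR) := by rw [hBR, mul_one]
        _ = (D * B * R) * BR := by simp only [mul_assoc]
        _ = 0 := by rw [hDB, zero_mul]
    intro h
    rw [← hDa, this]; rfl
  have hl : ∀ h, l h = 0 := fun h => by simpa using hD 0 h0 h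
  have hb : ∀ h y, b y h + b h y = 0 := by
    intro h
    have : b.flip h + b h = 0 := by
      apply hext
      intro y hy
      have := hD y hy h
      rw [hl, add_zero] at this
      exact this
    intro y
    exact congrArg (fun f : F →L[ℝ] F => f y) this
  have hs : s = 0 := by simpa using hq 0 h0
  have h2 := hb x x
  rw [← two_smul ℝ] at h2
  have h3 : b x x = 0 := (smul_eq_zero.1 h2).resolve_left two_ne_zero
  rw [h3, hl, hs]; simp

theorem linear_bound {X Y : Type*} [NormedAddCommGroup X] [NormedSpace ℝ X]
    [FiniteDimensional ℝ X] [NormedAddCommGroup Y] [NormedSpace ℝ Y] (f : X →ₗ[ℝ] Y) :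
    ∃ C > 0, ∀ x, ‖f x‖ ≤ C * ‖x‖ :=
  (LinearMap.toContinuousLinearMap f).bound

theorem quad_bound {T0 : Set F} (hsep : ∀ q : QM F, (∀ x ∈ T0, qev x q = 0) → ∀ x, qev x q = 0) :
    ∃ Y : Finset F, (∀ y ∈ Y, y ∈ T0) ∧ ∀ R : ℝ, ∃ C : ℝ, 0 < C ∧ ∀ q : QM F, ∀ M : ℝ, 0 ≤ M →
      (∀ y ∈ Y, ‖qev y q‖ ≤ M) → ∀ x, ‖x‖ ≤ R → ‖qev x q‖ ≤ C * M := by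
  classical
  let ker : Finset F → Submodule ℝ (QM F) := fun Y => LinearMap.ker (LinearMap.pi fun y : Y => qev (y : F))
  have hker : ∀ Y q, q ∈ ker Y ↔ ∀ y ∈ Y, qev y q = 0 := by
    intro Y q
    simp only [ker, LinearMap.mem_ker, funext_iff, LinearMap.pi_apply, Pi.zero_apply]
    exact ⟨fun h y hy => h ⟨y, hy⟩, fun h y => h y y.2⟩
  obtain ⟨K, ⟨Y, hYT, rfl⟩, hmin⟩ := IsArtinian.set_has_minimal
    {K | ∃ Y : Finset F, (∀ y ∈ Y, y ∈ T0) ∧ ker Y = K} ⟨_, ∅, by simp, rfl⟩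
  refine ⟨Y, hYT, fun R => ?_⟩
  have hall : ∀ q ∈ ker Y, ∀ x, qev x q = 0 := by
    intro q hq
    apply hsep
    intro x hx
    have hle : ker (insert x Y) ≤ ker Y := fun q hq => by
      rw [hker] at hq ⊢
      exact fun y hy => hq y (Finset.mem_insert_of_mem hy)
    have hnot := hmin (ker (insert x Y)) ⟨insert x Y, by
      intro y hy
      rcases Finset.mem_insert.1 hy with rfl | hy
      · exact hx
      · exact hYT y hy, rfl⟩
    have heq : ker (insert x Y) = ker Y := by
      by_contra hne
      exact hnot (lt_of_le_of_ne hle hne)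
    rw [← heq, hker] at hq
    exact hq x (Finset.mem_insert_self _ _)
  let ev : QM F →ₗ[ℝ] (Y → F) := LinearMap.pi fun y : Y => qev (y : F)
  obtain ⟨h1, hh1⟩ := LinearMap.exists_rightInverse_of_surjective ev.rangeRestrict
    (LinearMap.range_rangeRestrict ev)
  obtain ⟨h, hh⟩ := LinearMap.exists_extend h1
  have hev : ∀ q, ev (h (ev q)) = ev q := by
    intro q
    have e1 : h (ev q) = h1 (ev.rangeRestrict q) := by
      rw [← hh]; rfl
    rw [e1]
    have := congrArg (fun f => (f (ev.rangeRestrict q) : Y → F)) hh1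
    exact this
  obtain ⟨Ch, hCh, hc⟩ := linear_bound (X := Y → F) (Y := QM F) h
  refine ⟨(|R| * |R| + |R| + 1) * (Ch + 1), by positivity, ?_⟩
  intro q M hM0 hM x hx
  have hxR : ‖x‖ ≤ |R| := hx.trans (le_abs_self R)
  have e1 : qev x q = qev x (h (ev q)) := by
    have : q - h (ev q) ∈ ker Y := by
      change ev (q - h (ev q)) = 0
      rw [map_sub, hev, sub_self]
    have := hall _ this x
    rw [map_sub, sub_eq_zero] at this
    exact this
  have e2 : ‖ev q‖ ≤ M := (pi_norm_le_iff_of_nonneg hM0).2 fun y => hM y y.2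
  set w := h (ev q) with hw
  have e3 : ‖w‖ ≤ Ch * M := (hc _).trans (by gcongr)
  have n1 : ‖w.1‖ ≤ ‖w‖ := norm_fst_le _
  have n2 : ‖w.2.1‖ ≤ ‖w‖ := (norm_fst_le _).trans (norm_snd_le _)
  have n3 : ‖w.2.2‖ ≤ ‖w‖ := (norm_snd_le _).trans (norm_snd_le _)
  have n4 : ‖w.1 x x‖ ≤ ‖w‖ * |R| * |R| := by
    refine (w.1.le_opNorm₂ x x).trans ?_
    gcongr
  have n5 : ‖w.2.1 x‖ ≤ ‖w‖ * |R| := by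
    refine (w.2.1.le_opNorm x).trans ?_
    gcongr
  rw [e1, qev_apply]
  calc _ ≤ ‖w.1 x x‖ + ‖w.2.1 x‖ + ‖w.2.2‖ := norm_add₃_le
    _ ≤ ‖w‖ * |R| * |R| + ‖w‖ * |R| + ‖w‖ := by gcongr
    _ = (|R| * |R| + |R| + 1) * ‖w‖ := by ring
    _ ≤ (|R| * |R| + |R| + 1) * ((Ch + 1) * M) := by
      gcongr
      refine e3.trans ?_
      gcongr
      linarith
    _ = _ := by ring

end PartThree

section PartFour
variable {F : Type*} [NormedAddCommGroup F] [InnerProductSpace ℝ F] [FiniteDimensional ℝ F]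

theorem Simil.lim {ι : Type*} {l : Filter ι} [l.NeBot] {s : ι → ℝ} {O : ι → F →L[ℝ] F}
    {s0 : ℝ} {O0 : F →L[ℝ] F} (h : ∀ᶠ k in l, Simil (s k) (O k)) (hs : Tendsto s l (𝓝 s0))
    (hO : Tendsto O l (𝓝 O0)) (hs0 : 0 < s0) : Simil s0 O0 := by
  refine ⟨hs0, fun x => ?_⟩
  have h1 := (clm_apply_tendsto hO (tendsto_const_nhds (x := x))).norm
  have h2 := hs.mul_const ‖x‖
  refine tendsto_nhds_unique h1 (h2.congr' ?_)
  filter_upwards [h] with k hk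
  exact (hk.2 x).symm

theorem isClosed_NN (d : ℕ) (c : ℝ) (Λ : AddSubgroup (F × ℝ)) : IsClosed (NN d c Λ) := by
  have : NN d c Λ = ⋂ v ∈ Λ, ⋂ (_ : v.2 ≠ 0), {ξ | c ≤ |v.2| * ‖v.1 - v.2 • ξ‖ ^ d} := by
    ext ξ; simp [NN]
  rw [this]
  refine isClosed_biInter fun v _ => isClosed_iInter fun _ => ?_
  exact isClosed_le continuous_const (by fun_prop)

/-- The union of `Li^j T0`. -/
def Tinf (L : F →L[ℝ] F) (T0 : Set F) : Set F := {x | ∃ j : ℕ, ∀ i ≥ j, (L ^ i) x ∈ T0}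

theorem Lpow_mem {L : F →L[ℝ] F} {T0 : Set F} (hLT : ∀ x ∈ T0, L x ∈ T0) (n : ℕ) :
    ∀ x ∈ T0, (L ^ n) x ∈ T0 := by
  induction n with
  | zero => intro x hx; simpa using hx
  | succ n ih => intro x hx; rw [pow_succ, mul_apply_eq_comp]; exact ih _ (hLT x hx)

theorem mul_pow_inv {L Li : F →L[ℝ] F} (h1 : L * Li = 1) (n : ℕ) : L ^ n * Li ^ n = 1 := by
  induction n with
  | zero => simp
  | succ n ih =>
    rw [pow_succ, pow_succ', mul_assoc, ← mul_assoc L, h1, one_mul, ih]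

theorem pow_pow_apply {L Li : F →L[ℝ] F} (h1 : L * Li = 1) (n : ℕ) (x : F) :
    (L ^ n) ((Li ^ n) x) = x := by
  rw [← mul_apply_eq_comp, mul_pow_inv h1]; rfl

theorem pow_sub_apply {L Li : F →L[ℝ] F} (h1 : L * Li = 1) {n k : ℕ} (hk : k ≤ n) (x : F) :
    (L ^ n) ((Li ^ k) x) = (L ^ (n - k)) x := by
  obtain ⟨j, rfl⟩ := Nat.exists_eq_add_of_le' hk
  rw [pow_add, mul_apply_eq_comp, pow_pow_apply h1, Nat.add_sub_cancel]

theorem Tinf_L {L : F →L[ℝ] F} {T0 : Set F} (n : ℕ) {x : F} (hx : x ∈ Tinf L T0) :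
    (L ^ n) x ∈ Tinf L T0 := by
  obtain ⟨j, hj⟩ := hx
  refine ⟨j, fun i hi => ?_⟩
  rw [← mul_apply_eq_comp, ← pow_add]
  exact hj _ (by omega)

theorem Tinf_Li {L Li : F →L[ℝ] F} (h1 : L * Li = 1) {T0 : Set F} (n : ℕ) {x : F}
    (hx : x ∈ Tinf L T0) : (Li ^ n) x ∈ Tinf L T0 := by
  obtain ⟨j, hj⟩ := hx
  refine ⟨j + n, fun i hi => ?_⟩
  rw [pow_sub_apply h1 (by omega)]
  exact hj _ (by omega)

theorem Tinf_of_mem {L : F →L[ℝ] F} {T0 : Set F} (hLT : ∀ x ∈ T0, L x ∈ T0) {x : F}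
    (hx : x ∈ T0) : x ∈ Tinf L T0 := ⟨0, fun i _ => Lpow_mem hLT i x hx⟩

theorem hyperfilter_le_atTop : (hyperfilter ℕ : Filter ℕ) ≤ atTop := by
  rw [← Nat.cofinite_eq_atTop]; exact hyperfilter_le_cofinite

theorem exists_lattice_Tinf {d : ℕ} (hd : Module.finrank ℝ F = d) {c C0 : ℝ} (hc : 0 < c)
    {L Li : F →L[ℝ] F} {ρ : ℝ} (hLi : Simil ρ⁻¹ Li) (h2 : Li * L = 1)
    {T0 : Set F} (h0 : (0 : F) ∈ T0) (hLT : ∀ x ∈ T0, L x ∈ T0)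
    {Λ : AddSubgroup (F × ℝ)} (hg : Good C0 Λ) (hT : ∀ x ∈ T0, x ∈ NN d c Λ) :
    ∃ Λ' : AddSubgroup (F × ℝ), Good C0 Λ' ∧ ∀ x ∈ Tinf L T0, x ∈ NN d c Λ' := by
  let Λs : ℕ → AddSubgroup (F × ℝ) := fun j => act d (ρ⁻¹ ^ j) (Li ^ j) 0 Λ
  have hΛs : ∀ j, Good C0 (Λs j) := fun j => act_good hd (hLi.pow j) 0 hg
  have hnear : ∀ x ∈ Tinf L T0, NearNN d c (hyperfilter ℕ : Filter ℕ) Λs x := by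
    rintro x ⟨j, hj⟩
    apply nearNN_of_mem
    filter_upwards [hyperfilter_le_atTop (eventually_ge_atTop j)] with i hi
    have := act_NN (hLi.pow i) 0 (hT _ (hj i hi))
    rwa [pow_pow_apply h2, add_zero] at this
  refine ⟨Lim (hyperfilter ℕ : Filter ℕ) Λs, ?_, fun x hx => lim_NN _ _ (hnear x hx)⟩
  exact lim_good hc (hyperfilter ℕ) Λs (fun k => (hΛs k).1) (weakG2_of_G2 _ fun k => (hΛs k).2)
    (hnear 0 (Tinf_of_mem hLT h0))

def FamD (d : ℕ) (c C0 : ℝ) (T S : Set F) (s : ℝ) (O : F →L[ℝ] F) (Λ : AddSubgroup (F × ℝ)) :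
    Prop := Simil s O ∧ Good C0 Λ ∧ ∀ y ∈ T, ∀ σ ∈ S, y + O σ ∈ NN d c Λ

def Fam (d : ℕ) (c C0 : ℝ) (T S : Set F) : Prop := ∃ s O Λ, FamD d c C0 T S s O Λ

theorem Fam_trans {d : ℕ} (hd : Module.finrank ℝ F = d) {c C0 : ℝ} {T S : Set F}
    (h : Fam d c C0 T S) (τ : F) : Fam d c C0 T {x | x + τ ∈ S} := by
  obtain ⟨s, O, Λ, hO, hΛ, hN⟩ := h
  refine ⟨s, O, act d 1 1 (-(O τ)) Λ, hO, act_good hd Simil.one _ hΛ, fun y hy σ hσ => ?_⟩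
  have := act_NN (d := d) Simil.one (-(O τ)) (hN y hy _ hσ)
  convert this using 1
  simp only [one_apply_eq_self, map_add]; abel

theorem Fam_norm {d : ℕ} (hd : Module.finrank ℝ F = d) {c C0 : ℝ} {T S : Set F}
    {L Li : F →L[ℝ] F} {ρ : ℝ} (hL : Simil ρ L) (hρ : ρ < 1) (hLi : Simil ρ⁻¹ Li)
    (h1 : L * Li = 1) (h2 : Li * L = 1)
    (hTL : ∀ n : ℕ, ∀ x ∈ T, (L ^ n) x ∈ T) (hTLi : ∀ n : ℕ, ∀ x ∈ T, (Li ^ n) x ∈ T)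
    (h : Fam d c C0 T S) : ∃ s O Λ, FamD d c C0 T S s O Λ ∧ 1 ≤ s ∧ s ≤ ρ⁻¹ := by
  obtain ⟨s, O, Λ, hO, hΛ, hN⟩ := h
  obtain ⟨n, hn1, hn2⟩ := exists_mem_Ico_zpow hO.1 ((one_lt_inv₀ hL.1).2 hρ)
  have hρ0 := hL.1
  rcases Int.eq_nat_or_neg n with ⟨k, rfl | rfl⟩
  · refine ⟨ρ ^ k * s, L ^ k * O, act d (ρ ^ k) (L ^ k) 0 Λ,
      ⟨(hL.pow k).mul hO, act_good hd (hL.pow k) 0 hΛ, fun y hy σ hσ => ?_⟩, ?_, ?_⟩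
    · have := act_NN (hL.pow k) 0 (hN _ (hTLi k y hy) σ hσ)
      rwa [map_add, pow_pow_apply h1, add_zero] at this
    · rw [zpow_natCast, inv_pow] at hn1
      have := pow_pos hρ0 k
      rwa [inv_le_iff_one_le_mul₀' this] at hn1
    · rw [zpow_add₀ (inv_pos.2 hρ0).ne', zpow_natCast, inv_pow, zpow_one] at hn2
      have := pow_pos hρ0 k
      calc ρ ^ k * s ≤ ρ ^ k * ((ρ ^ k)⁻¹ * ρ⁻¹) := by gcongr
        _ = ρ⁻¹ := by field_simp
  · refine ⟨ρ⁻¹ ^ k * s, Li ^ k * O, act d (ρ⁻¹ ^ k) (Li ^ k) 0 Λ,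
      ⟨(hLi.pow k).mul hO, act_good hd (hLi.pow k) 0 hΛ, fun y hy σ hσ => ?_⟩, ?_, ?_⟩
    · have := act_NN (hLi.pow k) 0 (hN _ (hTL k y hy) σ hσ)
      rwa [map_add, pow_pow_apply h2, add_zero] at this
    · rw [zpow_neg, zpow_natCast, inv_pow, inv_inv] at hn1
      have := pow_pos hρ0 k
      rw [inv_pow]
      calc (1:ℝ) = (ρ ^ k)⁻¹ * ρ ^ k := by field_simp
        _ ≤ _ := by gcongr
    · rw [zpow_add₀ (inv_pos.2 hρ0).ne', zpow_neg, zpow_natCast, inv_pow, zpow_one, inv_inv] at hn2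
      have := pow_pos hρ0 k
      rw [inv_pow]
      calc (ρ ^ k)⁻¹ * s ≤ (ρ ^ k)⁻¹ * (ρ ^ k * ρ⁻¹) := by gcongr
        _ = ρ⁻¹ := by field_simp

theorem Fam_chain {d : ℕ} (hd : Module.finrank ℝ F = d) {c C0 : ℝ} (hc : 0 < c) {T : Set F}
    {L Li : F →L[ℝ] F} {ρ : ℝ} (hL : Simil ρ L) (hρ : ρ < 1) (hLi : Simil ρ⁻¹ Li)
    (h1 : L * Li = 1) (h2 : Li * L = 1) (h0T : (0 : F) ∈ T)
    (hTL : ∀ n : ℕ, ∀ x ∈ T, (L ^ n) x ∈ T) (hTLi : ∀ n : ℕ, ∀ x ∈ T, (Li ^ n) x ∈ T)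
    (C : Set (Set F)) (hC : ∀ S ∈ C, Fam d c C0 T S ∧ (0 : F) ∈ S) (hch : IsChain (· ⊆ ·) C)
    (hne : C.Nonempty) : Fam d c C0 T (⋃₀ C) := by
  have : Nonempty C := hne.to_subtype
  have hdir : IsDirected C (· ≤ ·) := ⟨fun a b => by
    rcases hch.total a.2 b.2 with h | h
    · exact ⟨b, h, le_rfl⟩
    · exact ⟨a, le_rfl, h⟩⟩
  let 𝒲 : Ultrafilter C := Ultrafilter.of atTop
  have h𝒲 : (𝒲 : Filter C) ≤ atTop := Ultrafilter.of_le _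
  have hex : ∀ k : C, ∃ s O Λ, FamD d c C0 T (k : Set F) s O Λ ∧ 1 ≤ s ∧ s ≤ ρ⁻¹ := fun k =>
    Fam_norm hd hL hρ hLi h1 h2 hTL hTLi (hC k k.2).1
  choose s O Λ hfam hs1 hs2 using hex
  obtain ⟨O', hO'⟩ := ulim 𝒲 O ρ⁻¹ (Eventually.of_forall fun k => (hfam k).1.norm_le.trans (hs2 k))
  obtain ⟨s', hs'⟩ := ulim 𝒲 s ρ⁻¹ (Eventually.of_forall fun k => by
    rw [Real.norm_of_nonneg (by linarith [hs1 k])]; exact hs2 k)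
  have hs'1 : 1 ≤ s' := ge_of_tendsto hs' (Eventually.of_forall hs1)
  have hnear : ∀ y ∈ T, ∀ σ ∈ ⋃₀ C, NearNN d c (𝒲 : Filter C) Λ (y + O' σ) := by
    rintro y hy σ ⟨k0, hk0, hσ⟩
    refine nearNN_of_tendsto (f := fun k => y + O k σ)
      (tendsto_const_nhds.add (clm_apply_tendsto hO' tendsto_const_nhds)) ?_
    filter_upwards [h𝒲 (eventually_ge_atTop ⟨k0, hk0⟩)] with k hk
    exact (hfam k).2.2 y hy σ (hk hσ)
  refine ⟨s', O', Lim (𝒲 : Filter C) Λ, Simil.lim (Eventually.of_forall fun k => (hfam k).1) hs' hO'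
    (by linarith), ?_, fun y hy σ hσ => lim_NN _ _ (hnear y hy σ hσ)⟩
  obtain ⟨S, hS⟩ := hne
  exact lim_good hc 𝒲 Λ (fun k => (hfam k).2.1.1) (weakG2_of_G2 _ fun k => (hfam k).2.1.2)
    (hnear 0 h0T 0 ⟨S, hS, (hC S hS).2⟩)

theorem exists_max {d : ℕ} (hd : Module.finrank ℝ F = d) {c C0 : ℝ} (hc : 0 < c) {T : Set F}
    {L Li : F →L[ℝ] F} {ρ : ℝ} (hL : Simil ρ L) (hρ : ρ < 1) (hLi : Simil ρ⁻¹ Li)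
    (h1 : L * Li = 1) (h2 : Li * L = 1) (h0T : (0 : F) ∈ T)
    (hTL : ∀ n : ℕ, ∀ x ∈ T, (L ^ n) x ∈ T) (hTLi : ∀ n : ℕ, ∀ x ∈ T, (Li ^ n) x ∈ T)
    {Λ0 : AddSubgroup (F × ℝ)} (hg : Good C0 Λ0) (hN : ∀ x ∈ T, x ∈ NN d c Λ0) :
    ∃ (S : Set F) (Λ : AddSubgroup (F × ℝ)), (0 : F) ∈ S ∧ Good C0 Λ ∧
      (∀ y ∈ T, ∀ σ ∈ S, y + σ ∈ NN d c Λ) ∧ ∀ S', S ⊆ S' → Fam d c C0 T S' → S' ⊆ S := by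
  obtain ⟨m, hm0, hm⟩ := zorn_subset_nonempty {S | Fam d c C0 T S ∧ (0 : F) ∈ S} (by
    intro C hCs hch hne
    refine ⟨⋃₀ C, ⟨Fam_chain hd hc hL hρ hLi h1 h2 h0T hTL hTLi C hCs hch hne, ?_⟩,
      fun s hs => Set.subset_sUnion_of_mem hs⟩
    obtain ⟨S, hS⟩ := hne
    exact ⟨S, hS, (hCs hS).2⟩) {0} ⟨⟨1, 1, Λ0, Simil.one, hg, by
      intro y hy σ hσ
      rw [Set.mem_singleton_iff] at hσ
      subst hσ
      simpa using hN y hy⟩, rfl⟩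
  obtain ⟨⟨s, O, Λ, hO, hΛ, hfam⟩, h0m⟩ := hm.prop
  obtain ⟨P, hP, hOP, hPO⟩ := hO.exists_inv
  have hPOa : ∀ x, P (O x) = x := fun x => by rw [← mul_apply_eq_comp, hPO]; rfl
  have hOPa : ∀ x, O (P x) = x := fun x => by rw [← mul_apply_eq_comp, hOP]; rfl
  refine ⟨O '' m, Λ, ⟨0, h0m, map_zero _⟩, hΛ, ?_, ?_⟩
  · rintro y hy _ ⟨σ, hσ, rfl⟩
    exact hfam y hy σ hσ
  · rintro S' hS' ⟨s', O', Λ', hO', hΛ', hfam'⟩ x hx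
    have hle : m ⊆ {z | O z ∈ S'} := fun z hz => hS' ⟨z, hz, rfl⟩
    have := hm.le_of_ge (y := {z | O z ∈ S'}) ⟨⟨s' * s, O' * O, Λ', hO'.mul hO, hΛ',
      fun y hy σ hσ => hfam' y hy _ hσ⟩, hle h0m⟩ hle
    exact ⟨P x, this (by rw [Set.mem_ofPred_eq, hOPa]; exact hx), hOPa x⟩

/-- From small elements of the stabiliser in every complement to a contradiction. -/
theorem finish_subgroup {d : ℕ} (hd0 : 1 ≤ d) {c C0 : ℝ} (hc : 0 < c) {T S : Set F}
    {Λ : AddSubgroup (F × ℝ)} (h0T : (0 : F) ∈ T) (h0S : (0 : F) ∈ S) (hg : Good C0 Λ)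
    (hN : ∀ y ∈ T, ∀ σ ∈ S, y + σ ∈ NN d c Λ)
    (hmax : ∀ S', S ⊆ S' → Fam d c C0 T S' → S' ⊆ S)
    (hA : ∀ W : Submodule ℝ F, W ≠ ⊤ → (∀ w ∈ W, ∀ σ ∈ S, σ + w ∈ S) → ∀ η > 0,
      ∃ σ0 ∈ Wᗮ, σ0 ≠ 0 ∧ ‖σ0‖ ≤ η ∧ ∀ σ ∈ S, σ + σ0 ∈ S ∧ σ - σ0 ∈ S) : False := by
  have hSc : IsClosed S := by
    have : closure S ⊆ S := by
      apply hmax _ subset_closure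
      refine ⟨1, 1, Λ, Simil.one, hg, fun y hy σ hσ => ?_⟩
      have hcl : IsClosed {σ | y + σ ∈ NN d c Λ} :=
        (isClosed_NN d c Λ).preimage (continuous_const.add continuous_id)
      exact (closure_minimal (fun σ hσ => hN y hy σ hσ) hcl) hσ
    exact isClosed_of_closure_subset this
  let St : Set F := {v | ∀ σ ∈ S, σ + v ∈ S}
  obtain ⟨W, hWS, hWmax⟩ := (wellFounded_gt (α := Submodule ℝ F)).has_min
    {W : Submodule ℝ F | ∀ w ∈ W, ∀ σ ∈ S, σ + w ∈ S} ⟨⊥, by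
      intro w hw σ hσ
      rw [Submodule.mem_bot] at hw
      simpa [hw] using hσ⟩
  by_cases hWtop : W = ⊤
  · obtain ⟨v, hv, hv0, -⟩ := hg.1 LinearMap.id (by simp)
    have hv2 : v.2 ≠ 0 := fun h => hv0 (hg.2 v hv h)
    have h1 : v.2⁻¹ • v.1 ∈ S := by
      have := hWS (v.2⁻¹ • v.1) (by rw [hWtop]; trivial) 0 h0S
      simpa using this
    have h2 := hN 0 h0T _ h1 v hv hv2
    rw [zero_add, smul_smul, mul_inv_cancel₀ hv2, one_smul, sub_self, norm_zero,
      zero_pow (by omega), mul_zero] at h2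
    linarith
  · have hσ := fun n : ℕ => hA W hWtop hWS (1 / ((n : ℝ) + 1)) (by positivity)
    choose σ hσW hσ0 hσn hσS using hσ
    have hpos : ∀ n, 0 < ‖σ n‖ := fun n => norm_pos_iff.2 (hσ0 n)
    obtain ⟨v, hv⟩ := ulim (hyperfilter ℕ) (fun n => ‖σ n‖⁻¹ • σ n) 1 (Eventually.of_forall fun n => by
      rw [norm_smul, norm_inv, norm_norm, inv_mul_cancel₀ (hpos n).ne'])
    have hv1 : ‖v‖ = 1 := by
      refine tendsto_nhds_unique hv.norm (tendsto_const_nhds.congr fun n => ?_)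
      rw [norm_smul, norm_inv, norm_norm, inv_mul_cancel₀ (hpos n).ne']
    have hvW : v ∈ Wᗮ := (Submodule.isClosed_orthogonal W).mem_of_tendsto hv
      (Eventually.of_forall fun n => Submodule.smul_mem _ _ (hσW n))
    have hσt : Tendsto (fun n => ‖σ n‖) (hyperfilter ℕ : Filter ℕ) (𝓝 0) :=
      squeeze_zero (fun n => norm_nonneg _) hσn
        (tendsto_one_div_add_atTop_nhds_zero_nat.mono_left hyperfilter_le_atTop)
    have hnat : ∀ n (k : ℕ), ∀ x ∈ S, x + (k : ℝ) • σ n ∈ S ∧ x - (k : ℝ) • σ n ∈ S := by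
      intro n k
      induction k with
      | zero => intro x hx; simpa using hx
      | succ k ih =>
        intro x hx
        have a1 := (ih _ (hσS n x hx).1).1
        have a2 := (ih _ (hσS n x hx).2).2
        constructor
        · convert a1 using 1; push_cast; module
        · convert a2 using 1; push_cast; module
    have hInt : ∀ n (k : ℤ), ∀ x ∈ S, x + (k : ℝ) • σ n ∈ S := by
      intro n k x hx
      rcases Int.eq_nat_or_neg k with ⟨j, rfl | rfl⟩
      · exact_mod_cast (hnat n j x hx).1
      · have := (hnat n j x hx).2
        push_cast
        rwa [neg_smul, ← sub_eq_add_neg]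
    have hline : ∀ t : ℝ, ∀ x ∈ S, x + t • v ∈ S := by
      intro t x hx
      have hlim : Tendsto (fun n => x + ((⌊t / ‖σ n‖⌋ : ℤ) : ℝ) • σ n) (hyperfilter ℕ : Filter ℕ)
          (𝓝 (x + t • v)) := by
        refine tendsto_const_nhds.add ?_
        have e1 : Tendsto (fun n => t • (‖σ n‖⁻¹ • σ n) - Int.fract (t / ‖σ n‖) • σ n)
            (hyperfilter ℕ : Filter ℕ) (𝓝 (t • v - 0)) := by
          refine (hv.const_smul t).sub ?_
          refine squeeze_zero_norm (fun n => ?_) hσt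
          rw [norm_smul, Real.norm_of_nonneg (Int.fract_nonneg _)]
          exact mul_le_of_le_one_left (norm_nonneg _) (Int.fract_lt_one _).le
        rw [sub_zero] at e1
        refine e1.congr fun n => ?_
        rw [smul_smul, ← div_eq_mul_inv, ← sub_smul, Int.self_sub_fract]
      exact hSc.mem_of_tendsto hlim (Eventually.of_forall fun n => hInt n _ x hx)
    apply hWmax (W ⊔ Submodule.span ℝ {v})
    · intro w hw x hx
      obtain ⟨a, ha, b, hb, rfl⟩ := Submodule.mem_sup.1 hw
      obtain ⟨t, rfl⟩ := Submodule.mem_span_singleton.1 hb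
      rw [← add_assoc]
      exact hline t _ (hWS a ha x hx)
    · change W < _
      refine lt_of_le_of_ne le_sup_left fun heq => ?_
      have hvW' : v ∈ W := by
        rw [heq]; exact Submodule.mem_sup_right (Submodule.mem_span_singleton_self v)
      have := Submodule.inner_right_of_mem_orthogonal hvW' hvW
      rw [real_inner_self_eq_norm_sq, hv1] at this
      norm_num at this

end PartFour

section PartFive
variable {F : Type*} [NormedAddCommGroup F] [InnerProductSpace ℝ F] [FiniteDimensional ℝ F]

/-- The displacement of the point `z` under the projective map of `g`. -/
def DD (g : (F × ℝ) →L[ℝ] (F × ℝ)) (z : F) : F := (g (z, 1)).1 - (g (z, 1)).2 • z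

def rr (g : (F × ℝ) →L[ℝ] (F × ℝ)) : F →L[ℝ] ℝ :=
  (ContinuousLinearMap.snd ℝ F ℝ).comp (g.comp (ContinuousLinearMap.inl ℝ F ℝ))

theorem rr_apply (g : (F × ℝ) →L[ℝ] (F × ℝ)) (p : F) : rr g p = (g (p, 0)).2 := rfl

def aa (g : (F × ℝ) →L[ℝ] (F × ℝ)) : F →L[ℝ] F :=
  (ContinuousLinearMap.fst ℝ F ℝ).comp (g.comp (ContinuousLinearMap.inl ℝ F ℝ))

theorem aa_apply (g : (F × ℝ) →L[ℝ] (F × ℝ)) (p : F) : aa g p = (g (p, 0)).1 := rfl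

theorem g_split (g : (F × ℝ) →L[ℝ] (F × ℝ)) (p : F) (q : ℝ) :
    g (p, q) = (aa g p + q • (g (0, 1)).1, rr g p + q * (g (0, 1)).2) := by
  have : ((p, q) : F × ℝ) = (p, 0) + q • (0, 1) := by simp
  rw [this, map_add, map_smul]
  ext <;> simp [aa_apply, rr_apply]

theorem DD_eq (g : (F × ℝ) →L[ℝ] (F × ℝ)) (z : F) :
    DD g z = aa g z + (g (0, 1)).1 - (rr g z + (g (0, 1)).2) • z := by
  rw [DD, g_split]; simp

theorem DD_small {g : (F × ℝ) →L[ℝ] (F × ℝ)} {δ : ℝ} (hδ : 0 ≤ δ) (hg : ‖g - 1‖ ≤ δ) (z : F) :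
    ‖DD g z‖ ≤ δ * (1 + ‖z‖) ^ 2 := by
  set e := (g - 1) (z, 1) with he
  have hz : ‖((z, 1) : F × ℝ)‖ ≤ 1 + ‖z‖ := by
    rw [Prod.norm_def]
    apply max_le
    · simp
    · simp
  have hen : ‖e‖ ≤ δ * (1 + ‖z‖) := (ContinuousLinearMap.le_opNorm _ _).trans (by gcongr)
  have e1 : g (z, 1) = (z, 1) + e := by
    simp [he, sub_apply, one_apply_eq_self]
  have e2 : DD g z = e.1 - e.2 • z := by
    rw [DD, e1]; simp [add_smul]
  rw [e2]
  calc _ ≤ ‖e.1‖ + ‖e.2 • z‖ := norm_sub_le _ _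
    _ ≤ ‖e‖ + ‖e‖ * ‖z‖ := by
      rw [norm_smul]
      have := norm_fst_le e
      have := norm_snd_le e
      gcongr
    _ = ‖e‖ * (1 + ‖z‖) := by ring
    _ ≤ δ * (1 + ‖z‖) * (1 + ‖z‖) := by gcongr
    _ = _ := by ring

theorem proj_le (U : Submodule ℝ F) (x : F) : ‖U.starProjection x‖ ≤ ‖x‖ :=
  Submodule.norm_starProjection_apply_le U x

theorem exists_test {U : Submodule ℝ F} (hU : U ≠ ⊤) (r : F →L[ℝ] ℝ) :
    ∃ z : F, ‖z‖ ≤ 2 ∧ ‖r‖ / 4 ≤ |r z| ∧ 1 / 2 ≤ ‖Uᗮ.starProjection z‖ := by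
  obtain ⟨n0, hn0, hn00⟩ : ∃ n ∈ Uᗮ, n ≠ 0 := by
    apply Submodule.exists_mem_ne_zero_of_ne_bot
    intro h
    exact hU ((Submodule.orthogonal_eq_bot_iff).1 h)
  set n := ‖n0‖⁻¹ • n0 with hn
  have hnU : n ∈ Uᗮ := Submodule.smul_mem _ _ hn0
  have hn1 : ‖n‖ = 1 := by
    rw [hn, norm_smul, norm_inv, norm_norm, inv_mul_cancel₀ (norm_ne_zero_iff.2 hn00)]
  have hpn : Uᗮ.starProjection n = n := Submodule.starProjection_eq_self_iff.2 hnU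
  obtain ⟨e, he1, her⟩ : ∃ e : F, ‖e‖ ≤ 1 ∧ ‖r‖ / 2 ≤ |r e| := by
    by_contra! hcon
    have : ‖r‖ ≤ ‖r‖ / 2 := by
      refine ContinuousLinearMap.opNorm_le_bound _ (by positivity) fun x => ?_
      by_cases hx : x = 0
      · simp [hx]
      have hx' := norm_pos_iff.2 hx
      have := (hcon (‖x‖⁻¹ • x) (by
        rw [norm_smul, norm_inv, norm_norm, inv_mul_cancel₀ hx'.ne'])).le
      rw [map_smul, smul_eq_mul, abs_mul, abs_inv, abs_norm, inv_mul_le_iff₀ hx'] at this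
      rw [Real.norm_eq_abs]; linarith
    have h0 : ‖r‖ = 0 := le_antisymm (by linarith) (norm_nonneg _)
    have := hcon 0 (by simp)
    rw [h0] at this
    simp at this
  have hr0 := norm_nonneg r
  by_cases c1 : ‖r‖ / 4 ≤ |r n|
  · exact ⟨n, by linarith, c1, by rw [hpn, hn1]; norm_num⟩
  by_cases c2 : 1 / 2 ≤ ‖Uᗮ.starProjection e‖
  · exact ⟨e, by linarith, by linarith, c2⟩
  push Not at c1 c2
  refine ⟨e + n, (norm_add_le _ _).trans (by linarith), ?_, ?_⟩
  · rw [map_add]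
    have := abs_sub_abs_le_abs_sub (r e) (-(r n))
    rw [abs_neg, sub_neg_eq_add] at this
    linarith
  · rw [map_add, hpn]
    have := norm_sub_norm_le n (-(Uᗮ.starProjection e))
    rw [norm_neg, sub_neg_eq_add, add_comm n] at this
    linarith

/-- The quadratic map `x ↦ π (D (K x))`. -/
def qD (π K : F →L[ℝ] F) (g : (F × ℝ) →L[ℝ] (F × ℝ)) : QM F :=
  (-(ContinuousLinearMap.smulRight ((rr g).comp K) (π.comp K)),
    π.comp ((aa g).comp K) - (g (0, 1)).2 • π.comp K, π (g (0, 1)).1)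

theorem qev_qD (π K : F →L[ℝ] F) (g : (F × ℝ) →L[ℝ] (F × ℝ)) (x : F) :
    qev x (qD π K g) = π (DD g (K x)) := by
  rw [qev_apply, DD_eq, qD]
  simp only [neg_apply, ContinuousLinearMap.smulRight_apply, smul_apply, sub_apply,
    ContinuousLinearMap.comp_apply, map_sub, map_add, map_smul]
  module

theorem rr_bound {U : Submodule ℝ F} (hU : U ≠ ⊤) {K : F →L[ℝ] F} {κ : ℝ} (hK : Simil κ K)
    {g : (F × ℝ) →L[ℝ] (F × ℝ)} {M : ℝ}
    (h : ∀ x, ‖x‖ ≤ 2 → ‖Uᗮ.starProjection (DD g (K x))‖ ≤ M) : ‖rr g‖ * κ ^ 2 ≤ 16 * M := by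
  obtain ⟨z, hz, hrz, hpz⟩ := exists_test hU (rr g)
  obtain ⟨P, hP, hKP, hPK⟩ := hK.exists_inv
  have hκ := hK.1
  set x := κ • P z with hx
  have hxn : ‖x‖ ≤ 2 := by
    rw [hx, norm_smul, hP.2, Real.norm_of_nonneg hκ.le, ← mul_assoc, mul_inv_cancel₀ hκ.ne', one_mul]
    exact hz
  have hKx : K x = κ • z := by
    rw [hx, map_smul, ← mul_apply_eq_comp, hKP]; rfl
  have h1 := h x hxn
  have h2 := h (-x) (by rwa [norm_neg])
  have h3 := h 0 (by simp)
  have key : Uᗮ.starProjection (DD g (K x)) + Uᗮ.starProjection (DD g (K (-x)))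
      - (2 : ℝ) • Uᗮ.starProjection (DD g (K 0)) = (-(2 * κ ^ 2 * rr g z)) • Uᗮ.starProjection z := by
    rw [map_neg, map_zero, hKx, DD_eq, DD_eq, DD_eq]
    simp only [map_add, map_sub, map_smul, map_neg, map_zero, smul_zero]
    simp only [smul_eq_mul]
    module
  have h4 : ‖(-(2 * κ ^ 2 * rr g z)) • Uᗮ.starProjection z‖ ≤ 4 * M := by
    rw [← key]
    calc _ ≤ ‖Uᗮ.starProjection (DD g (K x))‖ + ‖Uᗮ.starProjection (DD g (K (-x)))‖
        + ‖(2 : ℝ) • Uᗮ.starProjection (DD g (K 0))‖ :=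
          (norm_sub_le _ _).trans (by gcongr; exact norm_add_le _ _)
      _ ≤ M + M + 2 * M := by
        rw [norm_smul, Real.norm_of_nonneg (by norm_num : (0:ℝ) ≤ 2)]
        gcongr
      _ = _ := by ring
  rw [norm_smul, norm_neg, Real.norm_eq_abs, abs_mul, abs_of_nonneg (by positivity : 0 ≤ 2 * κ ^ 2)] at h4
  have h5 : 2 * κ ^ 2 * (‖rr g‖ / 4) * (1 / 2) ≤
      2 * κ ^ 2 * |rr g z| * ‖Uᗮ.starProjection z‖ := by gcongr
  nlinarith

theorem Simil.map_ne_top {s : ℝ} {O : F →L[ℝ] F} (h : Simil s O) {W : Submodule ℝ F} (hW : W ≠ ⊤) :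
    W.map (O : F →ₗ[ℝ] F) ≠ ⊤ := by
  obtain ⟨P, hP, hOP, hPO⟩ := h.exists_inv
  intro htop
  apply hW
  rw [Submodule.eq_top_iff']
  intro x
  have : O x ∈ W.map (O : F →ₗ[ℝ] F) := by rw [htop]; trivial
  obtain ⟨w, hw, hwx⟩ := this
  have h1 : P (O w) = P (O x) := congrArg P hwx
  rw [← mul_apply_eq_comp, ← mul_apply_eq_comp, hPO] at h1
  change w = x at h1
  rwa [← h1]

end PartFive

section PartSix
variable {F : Type*} [NormedAddCommGroup F] [InnerProductSpace ℝ F] [FiniteDimensional ℝ F]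

theorem claimA1 {d : ℕ} (hd : Module.finrank ℝ F = d) {c C0 : ℝ} (hc : 0 < c) (hC0 : 0 < C0)
    {Li : F →L[ℝ] F} {ρ : ℝ} (hρ0 : 0 < ρ) (hρ : ρ < 1) (hLi : Simil ρ⁻¹ Li)
    {Y : Finset F} (hY : ∀ R : ℝ, ∃ C : ℝ, 0 < C ∧ ∀ q : QM F, ∀ M : ℝ, 0 ≤ M →
      (∀ y ∈ Y, ‖qev y q‖ ≤ M) → ∀ x, ‖x‖ ≤ R → ‖qev x q‖ ≤ C * M)
    (Λs : ℕ → AddSubgroup (F × ℝ)) (hΛs : ∀ m, Good C0 (Λs m)) (h0 : ∀ m, (0 : F) ∈ NN d c (Λs m))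
    {a : ℝ} (Hs Hi : ℕ → F →L[ℝ] F) (hHs : ∀ m, Simil a (Hs m)) (hHi : ∀ m, Simil a⁻¹ (Hi m))
    (hHsi : ∀ m, Hs m * Hi m = 1) (ts : ℕ → F) {b : ℝ} (hb : 0 < b)
    (hts : ∀ m, ‖ts m‖ = ρ⁻¹ ^ m * b)
    (hrel : ∀ m l, ∀ v ∈ Λs m, ((Hs l * Hi m) v.1 - v.2 • (ts l - (Hs l * Hi m) (ts m)), v.2) ∈ Λs l)
    {W : Submodule ℝ F} (hW : W ≠ ⊤) :
    ∃ H : F →L[ℝ] F, Simil a H ∧ ∀ η > 0, ∃ η0 > 0, ∃ C2 : ℝ, ∀ k : ℕ, ∃ (m l j : ℕ) (y : F)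
      (g : (F × ℝ) →L[ℝ] (F × ℝ)), k ≤ j ∧ j ≤ m ∧ j ≤ l ∧ y ∈ Y ∧ ‖g - 1‖ ≤ 1 / ((k : ℝ) + 1) ∧
        (∀ v ∈ Λs m, g v ∈ Λs l) ∧ ‖Hs m - H‖ ≤ 1 / ((k : ℝ) + 1) ∧ ‖Hs l - H‖ ≤ 1 / ((k : ℝ) + 1) ∧
        η0 ≤ ‖((W.map (Hs l : F →ₗ[ℝ] F))ᗮ).starProjection (DD g ((Li ^ j) y))‖ ∧
        ‖((W.map (Hs l : F →ₗ[ℝ] F))ᗮ).starProjection (DD g ((Li ^ j) y))‖ ≤ η ∧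
        ‖rr g‖ * (ρ⁻¹ ^ j) ^ 2 ≤ C2 := by
  obtain ⟨𝒱, h𝒱⟩ := exists_gap_ultrafilter
  have ha : 0 < a := (hHs 0).1
  obtain ⟨H, hH⟩ := ulim 𝒱 Hs a (Eventually.of_forall fun m => (hHs m).norm_le)
  refine ⟨H, Simil.lim (Eventually.of_forall hHs) tendsto_const_nhds hH ha, fun η hη => ?_⟩
  obtain ⟨δ0, hδ0, c1, hc1, hR⟩ := lemma_R (F := F) hd hc hC0
  obtain ⟨YB, hYB0, hYB⟩ : ∃ B : ℝ, 0 ≤ B ∧ ∀ y ∈ Y, ‖y‖ ≤ B :=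
    ⟨∑ y ∈ Y, ‖y‖, Finset.sum_nonneg fun _ _ => norm_nonneg _,
      fun y hy => Finset.single_le_sum (f := fun y => ‖y‖) (fun _ _ => norm_nonneg _) hy⟩
  obtain ⟨Ca, hCa, hCaY⟩ := hY (ρ⁻¹ * YB)
  obtain ⟨Cb, hCb, hCbY⟩ := hY 2
  set R := ρ⁻¹ with hRdef
  have hR1 : 1 < R := (one_lt_inv₀ hρ0).2 hρ
  have hR0 : 0 < R := by linarith
  set η0 := η / Ca with hη0
  have hetapos : 0 < η0 := by positivity
  refine ⟨η0, hetapos, 16 * (Cb * η0) * R ^ 2, fun k => ?_⟩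
  -- choose the precision
  obtain ⟨δ, hδ, hδ1, hδ2, hδ3⟩ : ∃ δ > 0, δ ≤ 1 / ((k : ℝ) + 1) ∧ δ ≤ δ0 ∧
      δ * (1 + R ^ k * YB) ^ 2 < η0 := by
    have hZ : 0 < (1 + R ^ k * YB) ^ 2 := by positivity
    refine ⟨min (1 / ((k : ℝ) + 1)) (min δ0 (η0 / (2 * (1 + R ^ k * YB) ^ 2))), by positivity,
      min_le_left _ _, (min_le_right _ _).trans (min_le_left _ _), ?_⟩
    calc _ ≤ η0 / (2 * (1 + R ^ k * YB) ^ 2) * (1 + R ^ k * YB) ^ 2 := by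
          gcongr
          exact (min_le_right _ _).trans (min_le_right _ _)
      _ = η0 / 2 := by field_simp
      _ < η0 := by linarith
  obtain ⟨A1, hA1, hA1g⟩ := basis_stab hd hc Λs hΛs h0 𝒱 hδ
  have hHε := clm_norm_tendsto hH
  set ε := min (1 / ((k : ℝ) + 1)) (δ0 * a / 2) with hεdef
  have hε : 0 < ε := by positivity
  have hA2 : ∀ᶠ m in (𝒱 : Filter ℕ), ‖Hs m - H‖ < ε := (tendsto_order.1 hHε).2 ε hε
  have hA3 : ∀ᶠ m in (𝒱 : Filter ℕ), m ∈ A1 ∧ ‖Hs m - H‖ < ε := (show ∀ᶠ m in (𝒱 : Filter ℕ), m ∈ A1 from hA1).and hA2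
  obtain ⟨N, hN⟩ := h𝒱 _ hA3
  have hpow : Tendsto (fun m : ℕ => R ^ m) atTop atTop := tendsto_pow_atTop_atTop_of_one_lt hR1
  obtain ⟨K0, hK0⟩ := eventually_atTop.1
    ((hpow.eventually_ge_atTop (1 / (b * (1 - ρ)))).and
      (hpow.eventually_gt_atTop (16 * (Cb * η0) * (2 * R ^ N * b) / c1)))
  obtain ⟨m, l, hml, hlN, hKm, ⟨hmA, hmH⟩, hlA, hlH⟩ := hN K0
  obtain ⟨hm1, hm2⟩ := hK0 m hKm
  obtain ⟨g, hg1, hg⟩ := hA1g m hmA l hlA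
  set U := W.map (Hs l : F →ₗ[ℝ] F) with hU
  have hUtop : U ≠ ⊤ := (hHs l).map_ne_top hW
  set π := Uᗮ.starProjection with hπ
  -- lower bound for `rr g`
  set G := Hs l * Hi m with hG
  have hGS : Simil 1 G := by
    have := (hHs l).mul (hHi m)
    rwa [mul_inv_cancel₀ ha.ne'] at this
  have hG1 : ‖G - 1‖ ≤ δ0 := by
    have e : G - 1 = (Hs l - Hs m) * Hi m := by rw [sub_mul, hHsi m]
    rw [e]
    calc _ ≤ ‖Hs l - Hs m‖ * ‖Hi m‖ := norm_mul_le _ _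
      _ ≤ (ε + ε) * a⁻¹ := by
        gcongr
        · have : Hs l - Hs m = (Hs l - H) - (Hs m - H) := by abel
          rw [this]
          exact (norm_sub_le _ _).trans (by linarith)
        · exact (hHi m).norm_le
      _ ≤ (δ0 * a / 2 + δ0 * a / 2) * a⁻¹ := by gcongr <;> exact min_le_right _ _
      _ = δ0 := by field_simp; ring
  set t := ts l - G (ts m) with ht
  have hGt : ‖G (ts m)‖ = R ^ m * b := by rw [hGS.2, one_mul, hts]
  have hRm : 0 < R ^ m := by positivity
  have hRml : R * R ^ m ≤ R ^ l := by
    rw [← pow_succ']; exact pow_le_pow_right₀ hR1.le hml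
  have ht1 : 1 ≤ ‖t‖ := by
    have h1 := norm_sub_norm_le (ts l) (G (ts m))
    rw [hGt, hts] at h1
    have h2 : 1 ≤ R ^ m * (b * (1 - ρ)) := by
      rwa [div_le_iff₀ (mul_pos hb (by linarith))] at hm1
    have h3 : R * ρ = 1 := inv_mul_cancel₀ hρ0.ne'
    have h4 : R ^ m ≤ ρ * R ^ l := by
      calc R ^ m = ρ * (R * R ^ m) := by rw [← mul_assoc, mul_comm ρ, h3, one_mul]
        _ ≤ _ := by gcongr
    have h5 : R ^ m ≤ R ^ l := pow_le_pow_right₀ hR1.le hml.le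
    have h6 : R ^ l * b - R ^ m * b ≥ R ^ m * (b * (1 - ρ)) := by
      have : R ^ l * b * (1 - ρ) ≤ R ^ l * b - R ^ m * b := by nlinarith
      have h7 : R ^ m * (b * (1 - ρ)) ≤ R ^ l * b * (1 - ρ) := by
        rw [← mul_assoc]
        have : 0 ≤ 1 - ρ := by linarith
        gcongr
      linarith
    linarith
  have ht2 : ‖t‖ ≤ 2 * R ^ N * b * R ^ m := by
    have h1 := norm_sub_le (ts l) (G (ts m))
    rw [hGt, hts] at h1
    have h2 : R ^ l ≤ R ^ N * R ^ m := by
      rw [← pow_add]; exact pow_le_pow_right₀ hR1.le (by omega)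
    have h3 : R ^ m ≤ R ^ N * R ^ m := le_mul_of_one_le_left hRm.le (one_le_pow₀ hR1.le)
    calc ‖t‖ ≤ R ^ l * b + R ^ m * b := h1
      _ ≤ (R ^ N * R ^ m) * b + (R ^ N * R ^ m) * b := by gcongr
      _ = _ := by ring
  have hrlow : c1 ≤ ‖rr g‖ * ‖t‖ :=
    hR (Λs m) (Λs l) G t g (hΛs m) (hΛs l) (h0 m) (h0 l) (hrel m l) hg hG1 (hg1.trans hδ2) ht1 _
      (norm_nonneg _) (fun p => (rr g).le_opNorm p)
  -- the first big index
  have hsmall : ∀ j ≤ k, ∀ y ∈ Y, ‖π (DD g ((Li ^ j) y))‖ < η0 := by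
    intro j hj y hy
    refine lt_of_le_of_lt (proj_le _ _) (lt_of_le_of_lt (DD_small hδ.le hg1 _) ?_)
    refine lt_of_le_of_lt ?_ hδ3
    have : ‖(Li ^ j) y‖ ≤ R ^ k * YB := by
      rw [(hLi.pow j).2]
      have := hYB y hy
      have := pow_le_pow_right₀ hR1.le hj
      gcongr
    gcongr
  have hrrb : ∀ j, (∀ y ∈ Y, ‖π (DD g ((Li ^ j) y))‖ < η0) → ‖rr g‖ * (R ^ j) ^ 2 ≤ 16 * (Cb * η0) := by
    intro j hj
    refine rr_bound hUtop (hLi.pow j) fun x hx => ?_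
    have := hCbY (qD π (Li ^ j) g) η0 hetapos.le (fun y hy => by
      rw [qev_qD]; exact (hj y hy).le) x hx
    rwa [qev_qD] at this
  have hbig : ∃ j, j ≤ m ∧ ∃ y ∈ Y, η0 ≤ ‖π (DD g ((Li ^ j) y))‖ := by
    by_contra! hcon
    have h1 := hrrb m (hcon m le_rfl)
    rw [div_lt_iff₀ hc1] at hm2
    have h2 : c1 * R ^ m ≤ 16 * (Cb * η0) * (2 * R ^ N * b) := by
      calc c1 * R ^ m ≤ ‖rr g‖ * ‖t‖ * R ^ m := by gcongr
        _ ≤ ‖rr g‖ * (2 * R ^ N * b * R ^ m) * R ^ m := by gcongr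
        _ = (‖rr g‖ * (R ^ m) ^ 2) * (2 * R ^ N * b) := by ring
        _ ≤ _ := by gcongr
    linarith
  classical
  set j := Nat.find hbig with hjdef
  obtain ⟨hjm, y, hyY, hyη⟩ := Nat.find_spec hbig
  rw [← hjdef] at hjm hyη
  have hkj : k < j := by
    by_contra! hcon
    have := hsmall j hcon y hyY
    linarith
  obtain ⟨i, hi⟩ : ∃ i, j = i + 1 := ⟨j - 1, by omega⟩
  have hprev : ∀ y ∈ Y, ‖π (DD g ((Li ^ i) y))‖ < η0 := by
    intro y hy
    by_contra! hcon
    have := Nat.find_min hbig (m := i) (by omega)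
    exact this ⟨by omega, y, hy, hcon⟩
  refine ⟨m, l, j, y, g, hkj.le, hjm, by omega, hyY, hg1.trans hδ1, hg, hmH.le.trans (min_le_left _ _),
    hlH.le.trans (min_le_left _ _), hyη, ?_, ?_⟩
  · have := hCaY (qD π (Li ^ i) g) η0 hetapos.le (fun y hy => by
      rw [qev_qD]; exact (hprev y hy).le) (Li y) (by
        rw [hLi.2]; have := hYB y hyY; gcongr)
    rw [qev_qD, ← mul_apply_eq_comp, ← pow_succ, ← hi, hη0, mul_div_cancel₀ _ hCa.ne'] at this
    exact this
  · have := hrrb i hprev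
    calc ‖rr g‖ * (R ^ j) ^ 2 = ‖rr g‖ * (R ^ i) ^ 2 * R ^ 2 := by rw [hi]; ring
      _ ≤ _ := by gcongr

end PartSix

section PartSeven
variable {F : Type*} [NormedAddCommGroup F] [InnerProductSpace ℝ F] [FiniteDimensional ℝ F]

theorem Simil.inner_map {s : ℝ} {O : F →L[ℝ] F} (h : Simil s O) (x y : F) :
    inner ℝ (O x) (O y) = s ^ 2 * inner ℝ x y := by
  rw [real_inner_eq_norm_add_mul_self_sub_norm_mul_self_sub_norm_mul_self_div_two,
    real_inner_eq_norm_add_mul_self_sub_norm_mul_self_sub_norm_mul_self_div_two x y,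
    ← map_add, h.2, h.2, h.2]
  ring

theorem Simil.conj {s ρ : ℝ} {B L Li : F →L[ℝ] F} (h : Simil s B) (hL : Simil ρ L)
    (hLi : Simil ρ⁻¹ Li) (m : ℕ) : Simil s (Li ^ m * B * L ^ m) := by
  have := ((hLi.pow m).mul h).mul (hL.pow m)
  convert this using 1
  have := (pow_pos hL.1 m).ne'
  rw [inv_pow]; field_simp

theorem conj_mul_conj {A B L Li : F →L[ℝ] F} (h1 : L * Li = 1) (h2 : Li * L = 1) (hAB : A * B = 1)
    (m : ℕ) : (Li ^ m * A * L ^ m) * (Li ^ m * B * L ^ m) = 1 := by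
  have e1 := mul_pow_inv h1 m
  have e2 := mul_pow_inv h2 m
  calc _ = Li ^ m * A * (L ^ m * Li ^ m) * B * L ^ m := by simp only [mul_assoc]
    _ = Li ^ m * (A * B) * L ^ m := by rw [e1, mul_one]; simp only [mul_assoc]
    _ = 1 := by rw [hAB, mul_one, e2]

theorem finite_const {Y : Finset F} (y : ℕ → F) (hy : ∀ k, y k ∈ Y) :
    ∃ y' ∈ Y, ∀ᶠ k in (hyperfilter ℕ : Filter ℕ), y k = y' := by
  have h : (⋃ y' ∈ (Y : Set F), {k | y k = y'}) ∈ hyperfilter ℕ := by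
    have : (⋃ y' ∈ (Y : Set F), {k | y k = y'}) = Set.univ := by
      ext k; simpa using hy k
    rw [this]; exact Filter.univ_mem
  obtain ⟨y', h1, h2⟩ := (Ultrafilter.finite_biUnion_mem_iff Y.finite_toSet).1 h
  exact ⟨y', h1, h2⟩

theorem claimA2 {d : ℕ} (hd : Module.finrank ℝ F = d) {c C0 : ℝ} (hc : 0 < c)
    {L Li : F →L[ℝ] F} {ρ : ℝ} (hρ : ρ < 1) (hL : Simil ρ L) (hLi : Simil ρ⁻¹ Li)
    (h1 : L * Li = 1) (h2 : Li * L = 1)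
    {T0 S : Set F} (h0T : (0 : F) ∈ Tinf L T0) (h0S : (0 : F) ∈ S)
    {W : Submodule ℝ F} (hWS : ∀ w ∈ W, ∀ σ ∈ S, σ + w ∈ S)
    (Λs : ℕ → AddSubgroup (F × ℝ)) (hΛs : ∀ m, Good C0 (Λs m)) {a : ℝ} (Hs : ℕ → F →L[ℝ] F)
    {H : F →L[ℝ] F} 
    (hfact : ∀ m j, j ≤ m → ∀ z ∈ T0, ∀ σ ∈ S, (Li ^ j) z + Hs m σ ∈ NN d c (Λs m))
    {η0 η C2 : ℝ} (m l j : ℕ → ℕ) (y : ℕ → F) (g : ℕ → (F × ℝ) →L[ℝ] (F × ℝ))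
    (hkj : ∀ k, k ≤ j k) (hjm : ∀ k, j k ≤ m k) (hjl : ∀ k, j k ≤ l k)
    (hg1 : ∀ k : ℕ, ‖g k - 1‖ ≤ 1 / ((k : ℝ) + 1)) (hg : ∀ k, ∀ v ∈ Λs (m k), g k v ∈ Λs (l k))
    (hHm : ∀ k : ℕ, ‖Hs (m k) - H‖ ≤ 1 / ((k : ℝ) + 1))
    (hHl : ∀ k : ℕ, ‖Hs (l k) - H‖ ≤ 1 / ((k : ℝ) + 1))
    (hlow : ∀ k, η0 ≤ ‖((W.map (Hs (l k) : F →ₗ[ℝ] F))ᗮ).starProjection (DD (g k) ((Li ^ (j k)) (y k)))‖)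
    (hupp : ∀ k, ‖((W.map (Hs (l k) : F →ₗ[ℝ] F))ᗮ).starProjection (DD (g k) ((Li ^ (j k)) (y k)))‖ ≤ η)
    (hrr : ∀ k, ‖rr (g k)‖ * (ρ⁻¹ ^ (j k)) ^ 2 ≤ C2)
    {y' : F} (hy' : ∀ᶠ k in (hyperfilter ℕ : Filter ℕ), y k = y')
    {s' : ℝ} {B' : F →L[ℝ] F} (hB' : Simil s' B') (hB'T : ∀ x ∈ T0, B' x + y' ∈ T0) :
    ∃ (Λ' : AddSubgroup (F × ℝ)) (Q : F →L[ℝ] F) (σ' : F), Good C0 Λ' ∧ Simil s' Q ∧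
      η0 ≤ ‖σ'‖ ∧ ‖σ'‖ ≤ η ∧ (∀ w ∈ W, inner ℝ (H w) σ' = 0) ∧
      ∀ x ∈ Tinf L T0, ∀ σ ∈ S, Q x + H σ ∈ NN d c Λ' ∧ Q x + H σ - σ' ∈ NN d c Λ' := by
  have hρ0 := hL.1
  have htop : (hyperfilter ℕ : Filter ℕ) ≤ atTop := hyperfilter_le_atTop
  have hone : Tendsto (fun k : ℕ => 1 / ((k : ℝ) + 1)) (hyperfilter ℕ : Filter ℕ) (𝓝 0) :=
    tendsto_one_div_add_atTop_nhds_zero_nat.mono_left htop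
  have hHmt : Tendsto (fun k => Hs (m k)) (hyperfilter ℕ : Filter ℕ) (𝓝 H) := by
    rw [tendsto_iff_norm_sub_tendsto_zero]
    exact squeeze_zero (fun _ => norm_nonneg _) hHm hone
  have hHlt : Tendsto (fun k => Hs (l k)) (hyperfilter ℕ : Filter ℕ) (𝓝 H) := by
    rw [tendsto_iff_norm_sub_tendsto_zero]
    exact squeeze_zero (fun _ => norm_nonneg _) hHl hone
  have hgt : Tendsto g (hyperfilter ℕ : Filter ℕ) (𝓝 1) := by
    refine (tendsto_iff_norm_sub_tendsto_zero (E := (F × ℝ) →L[ℝ] (F × ℝ))).2 ?_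
    exact squeeze_zero (fun _ => ContinuousLinearMap.opNorm_nonneg _) hg1 hone
  set τ : ℕ → F := fun k => (Li ^ (j k)) (y k) with hτ
  set π : ℕ → F →L[ℝ] F := fun k => ((W.map (Hs (l k) : F →ₗ[ℝ] F))ᗮ).starProjection with hπ
  obtain ⟨σ', hσ'⟩ := ulim (hyperfilter ℕ) (fun k => π k (DD (g k) (τ k))) η
    (Eventually.of_forall hupp)
  set Qs : ℕ → F →L[ℝ] F := fun k => Li ^ (j k) * B' * L ^ (j k) with hQs
  have hQsS : ∀ k, Simil s' (Qs k) := fun k => hB'.conj hL hLi (j k)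
  obtain ⟨Q, hQ⟩ := ulim (hyperfilter ℕ) Qs s' (Eventually.of_forall fun k => (hQsS k).norm_le)
  have hrτ : Tendsto (fun k => ‖rr (g k)‖ * ‖τ k‖) (hyperfilter ℕ : Filter ℕ) (𝓝 0) := by
    have e1 : Tendsto (fun k : ℕ => |C2| * ‖y'‖ * ρ ^ k) (hyperfilter ℕ : Filter ℕ) (𝓝 (|C2| * ‖y'‖ * 0)) :=
      ((tendsto_pow_atTop_nhds_zero_of_lt_one hρ0.le hρ).mono_left htop).const_mul _
    rw [mul_zero] at e1
    refine squeeze_zero' (Eventually.of_forall fun k => by positivity) ?_ e1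
    filter_upwards [hy'] with k hk
    have e2 : ‖τ k‖ = ρ⁻¹ ^ (j k) * ‖y'‖ := by rw [hτ]; simp only [hk]; rw [(hLi.pow _).2]
    have e3 := hrr k
    have e4 : ρ ^ (j k) ≤ ρ ^ k := pow_le_pow_of_le_one hρ0.le hρ.le (hkj k)
    have e5 : ρ⁻¹ ^ (j k) * ρ ^ (j k) = 1 := by
      rw [← mul_pow, inv_mul_cancel₀ hρ0.ne', one_pow]
    have e6 : 0 < ρ⁻¹ ^ (j k) := by positivity
    calc ‖rr (g k)‖ * ‖τ k‖ = (‖rr (g k)‖ * (ρ⁻¹ ^ (j k)) ^ 2) * ‖y'‖ * ρ ^ (j k) := by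
          rw [e2]
          linear_combination (-(‖rr (g k)‖ * ρ⁻¹ ^ (j k) * ‖y'‖)) * e5
      _ ≤ |C2| * ‖y'‖ * ρ ^ k := by
          have := e3.trans (le_abs_self C2)
          gcongr
  set Λk : ℕ → AddSubgroup (F × ℝ) := fun k => act d 1 1 (-(τ k)) (Λs (m k)) with hΛk
  have hmem : ∀ x ∈ Tinf L T0, ∀ᶠ k in (hyperfilter ℕ : Filter ℕ), ∃ z ∈ T0,
      τ k + Qs k x = (Li ^ (j k)) z := by
    rintro x ⟨J, hJ⟩
    filter_upwards [hy', htop (eventually_ge_atTop J)] with k hk hkJ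
    refine ⟨_, hB'T _ (hJ (j k) (hkJ.trans (hkj k))), ?_⟩
    rw [hτ, hQs]
    simp only [hk, mul_apply_eq_comp, map_add]
    abel
  have hnear : ∀ x ∈ Tinf L T0, ∀ σ ∈ S, NearNN d c (hyperfilter ℕ : Filter ℕ) Λk (Q x + H σ) := by
    intro x hx σ hσ
    refine nearNN_of_tendsto (f := fun k => Qs k x + Hs (m k) σ)
      ((clm_apply_tendsto hQ tendsto_const_nhds).add (clm_apply_tendsto hHmt tendsto_const_nhds)) ?_
    filter_upwards [hmem x hx] with k ⟨z, hz, hzk⟩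
    have := act_NN (d := d) Simil.one (-(τ k)) (hfact (m k) (j k) (hjm k) z hz σ hσ)
    rw [← hzk, one_apply_eq_self] at this
    convert this using 1
    abel
  refine ⟨Lim (hyperfilter ℕ : Filter ℕ) Λk, Q, σ', ?_, ?_, ?_, ?_, ?_, fun x hx σ hσ =>
    ⟨lim_NN _ _ (hnear x hx σ hσ), ?_⟩⟩
  · exact lim_good hc (hyperfilter ℕ) Λk (fun k => act_G1 hd Simil.one _ (hΛs _).1)
      (weakG2_of_G2 _ fun k => act_G2 Simil.one _ (hΛs _).2) (hnear 0 h0T 0 h0S)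
  · exact Simil.lim (Eventually.of_forall hQsS) tendsto_const_nhds hQ hB'.1
  · exact ge_of_tendsto hσ'.norm (Eventually.of_forall hlow)
  · exact le_of_tendsto hσ'.norm (Eventually.of_forall hupp)
  · intro w hw
    have e1 : Tendsto (fun k => inner ℝ (Hs (l k) w) (π k (DD (g k) (τ k)))) (hyperfilter ℕ : Filter ℕ)
        (𝓝 (inner ℝ (H w) σ')) := (clm_apply_tendsto hHlt tendsto_const_nhds).inner hσ'
    refine tendsto_nhds_unique e1 (tendsto_const_nhds.congr fun k => ?_)
    exact (Submodule.inner_right_of_mem_orthogonal (K := W.map (Hs (l k) : F →ₗ[ℝ] F))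
      ⟨w, hw, rfl⟩ (Submodule.starProjection_apply_mem _ _)).symm
  · rintro v ⟨f, hf, hfv⟩ hv0
    have hu : ∀ k, ((f k).1 + (f k).2 • τ k, (f k).2) ∈ Λs (m k) := by
      intro k
      obtain ⟨u, hu, hfu⟩ := mem_act.1 (hf k)
      rw [lamOf_one] at hfu
      rw [← hfu]
      simpa using hu
    set n : ℕ → ℝ := fun k => rr (g k) (f k).1 + (f k).2 * (rr (g k) (τ k) + (g k (0, 1)).2) with hn
    have hgu : ∀ k, g k ((f k).1 + (f k).2 • τ k, (f k).2) =
        (aa (g k) (f k).1 + (f k).2 • (aa (g k) (τ k) + (g k (0, 1)).1), n k) := by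
      intro k
      rw [g_split]
      simp only [map_add, map_smul, hn, smul_add, smul_eq_mul, mul_add]
      ext
      · simp [add_assoc]
      · simp [add_assoc]
    have hf1 : Tendsto (fun k => (f k).1) (hyperfilter ℕ : Filter ℕ) (𝓝 v.1) :=
      (continuous_fst.tendsto v).comp hfv
    have hf2 : Tendsto (fun k => (f k).2) (hyperfilter ℕ : Filter ℕ) (𝓝 v.2) :=
      (continuous_snd.tendsto v).comp hfv
    have hrf : Tendsto (fun k => rr (g k) (f k).1) (hyperfilter ℕ : Filter ℕ) (𝓝 0) := by
      have e := clm_apply_tendsto hgt (hf1.prodMk_nhds (tendsto_const_nhds (x := (0 : ℝ))))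
      exact (continuous_snd.tendsto _).comp e
    have haf : Tendsto (fun k => aa (g k) (f k).1) (hyperfilter ℕ : Filter ℕ) (𝓝 v.1) := by
      have e := clm_apply_tendsto hgt (hf1.prodMk_nhds (tendsto_const_nhds (x := (0 : ℝ))))
      exact (continuous_fst.tendsto ((1 : (F × ℝ) →L[ℝ] (F × ℝ)) (v.1, 0))).comp e
    have hg01 : Tendsto (fun k => (g k ((0 : F), (1 : ℝ))).2) (hyperfilter ℕ : Filter ℕ) (𝓝 1) := by
      have e := clm_apply_tendsto hgt (tendsto_const_nhds (x := ((0 : F), (1 : ℝ))))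
      exact (continuous_snd.tendsto _).comp e
    have hrτ' : Tendsto (fun k => rr (g k) (τ k)) (hyperfilter ℕ : Filter ℕ) (𝓝 0) :=
      squeeze_zero_norm (fun k => (rr (g k)).le_opNorm _) hrτ
    have hnt : Tendsto n (hyperfilter ℕ : Filter ℕ) (𝓝 v.2) := by
      have := hrf.add (hf2.mul (hrτ'.add hg01))
      simpa using this
    have hrfτ : Tendsto (fun k => rr (g k) (f k).1 • τ k) (hyperfilter ℕ : Filter ℕ) (𝓝 0) := by
      have e : Tendsto (fun k => (‖rr (g k)‖ * ‖τ k‖) * ‖(f k).1‖) (hyperfilter ℕ : Filter ℕ)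
        (𝓝 (0 * ‖v.1‖)) := hrτ.mul hf1.norm
      rw [zero_mul] at e
      refine squeeze_zero_norm (fun k => ?_) e
      rw [norm_smul]
      calc _ ≤ (‖rr (g k)‖ * ‖(f k).1‖) * ‖τ k‖ := by
            gcongr; exact (rr (g k)).le_opNorm _
        _ = _ := by ring
    have hlim : Tendsto (fun k => |n k| * ‖aa (g k) (f k).1 - rr (g k) (f k).1 • τ k
        + (f k).2 • π k (DD (g k) (τ k)) - n k • (Qs k x + Hs (l k) σ)‖ ^ d)
        (hyperfilter ℕ : Filter ℕ)
        (𝓝 (|v.2| * ‖v.1 - 0 + v.2 • σ' - v.2 • (Q x + H σ)‖ ^ d)) := by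
      refine hnt.abs.mul (Tendsto.pow (Tendsto.norm ?_) d)
      exact (((haf.sub hrfτ).add (hf2.smul hσ')).sub (hnt.smul
        ((clm_apply_tendsto hQ tendsto_const_nhds).add (clm_apply_tendsto hHlt tendsto_const_nhds))))
    have e0 : v.1 - v.2 • (Q x + H σ - σ') = v.1 - 0 + v.2 • σ' - v.2 • (Q x + H σ) := by module
    rw [e0]
    refine ge_of_tendsto hlim ?_
    have hnne : ∀ᶠ k in (hyperfilter ℕ : Filter ℕ), n k ≠ 0 := hnt.eventually_ne hv0
    filter_upwards [hnne, hmem x hx] with k hnk ⟨z, hz, hzk⟩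
    set D := DD (g k) (τ k) with hD
    have hw0 : D - π k D ∈ W.map (Hs (l k) : F →ₗ[ℝ] F) := by
      have e := Submodule.sub_starProjection_mem_orthogonal (K := (W.map (Hs (l k) : F →ₗ[ℝ] F))ᗮ) D
      rwa [Submodule.orthogonal_orthogonal] at e
    obtain ⟨w, hwW, hw⟩ := hw0
    have hw' : Hs (l k) w = D - π k D := hw
    have e1 := hfact (l k) (j k) (hjl k) z hz (σ + ((f k).2 / n k) • w)
      (hWS _ (W.smul_mem _ hwW) σ hσ)
    have e2 := e1 _ (hg k _ (hu k)) (by rw [hgu k]; exact hnk)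
    rw [hgu k] at e2
    simp only at e2
    refine le_of_le_of_eq e2 ?_
    congr 3
    rw [← hzk, map_add, map_smul, hw']
    have e3 : n k • (((f k).2 / n k) • (D - π k D)) = (f k).2 • (D - π k D) := by
      rw [smul_smul, mul_div_cancel₀ _ hnk]
    rw [smul_add, smul_add, smul_add, smul_add, e3]
    rw [hD, DD_eq, hn]
    simp only [smul_add, add_smul, smul_sub, mul_add]
    module

end PartSeven

section PartEight
variable {F : Type*} [NormedAddCommGroup F] [InnerProductSpace ℝ F] [FiniteDimensional ℝ F]

theorem claimA {d : ℕ} (hd : Module.finrank ℝ F = d) (hd0 : 1 ≤ d) {c C0 : ℝ} (hc : 0 < c)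
    (hC0 : 0 < C0)
    {L Li : F →L[ℝ] F} {ρ : ℝ} (hρ : ρ < 1) (hL : Simil ρ L) (hLi : Simil ρ⁻¹ Li)
    (h1 : L * Li = 1) (h2 : Li * L = 1)
    {T0 S : Set F} (h0 : (0 : F) ∈ T0) (hLT : ∀ x ∈ T0, L x ∈ T0)
    (hspan : Submodule.span ℝ T0 = ⊤)
    (hT : ∀ y ∈ T0, ∃ (s : ℝ) (B : F →L[ℝ] F), Simil s B ∧ ∀ x ∈ T0, B x + y ∈ T0)
    (h0S : (0 : F) ∈ S) {Λ : AddSubgroup (F × ℝ)} (hg : Good C0 Λ)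
    (hN : ∀ y ∈ Tinf L T0, ∀ σ ∈ S, y + σ ∈ NN d c Λ)
    (hmax : ∀ S', S ⊆ S' → Fam d c C0 (Tinf L T0) S' → S' ⊆ S)
    (W : Submodule ℝ F) (hW : W ≠ ⊤) (hWS : ∀ w ∈ W, ∀ σ ∈ S, σ + w ∈ S) (η : ℝ) (hη : 0 < η) :
    ∃ σ0 ∈ Wᗮ, σ0 ≠ 0 ∧ ‖σ0‖ ≤ η ∧ ∀ σ ∈ S, σ + σ0 ∈ S ∧ σ - σ0 ∈ S := by
  have hρ0 := hL.1
  obtain ⟨Y, hYT, hY⟩ := quad_bound (T0 := T0) (fun q hq => quad_sep hL hρ h0 hLT hspan hT q hq)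
  obtain ⟨y0, hy0T, hy00⟩ : ∃ y0 ∈ T0, y0 ≠ 0 := by
    by_contra! hcon
    have : Submodule.span ℝ T0 = ⊥ := Submodule.span_eq_bot.2 hcon
    rw [hspan] at this
    have e : Module.finrank ℝ (⊤ : Submodule ℝ F) = Module.finrank ℝ (⊥ : Submodule ℝ F) := by rw [this]
    rw [finrank_top, finrank_bot, hd] at e
    omega
  obtain ⟨rb, B, hB, hBT⟩ := hT y0 hy0T
  obtain ⟨Bi, hBi, hBBi, hBiB⟩ := hB.exists_inv
  have hrb := hB.1
  let Hs : ℕ → F →L[ℝ] F := fun m => Li ^ m * Bi * L ^ m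
  let Hi : ℕ → F →L[ℝ] F := fun m => Li ^ m * B * L ^ m
  have hHs : ∀ m, Simil rb⁻¹ (Hs m) := fun m => hBi.conj hL hLi m
  have hHi : ∀ m, Simil rb⁻¹⁻¹ (Hi m) := fun m => by rw [inv_inv]; exact hB.conj hL hLi m
  have hHsHi : ∀ m, Hs m * Hi m = 1 := fun m => conj_mul_conj h1 h2 hBiB m
  have hHiHs : ∀ m, Hi m * Hs m = 1 := fun m => conj_mul_conj h1 h2 hBBi m
  let ts : ℕ → F := fun m => (Li ^ m) (Bi y0)
  have hts : ∀ m, ‖ts m‖ = ρ⁻¹ ^ m * (rb⁻¹ * ‖y0‖) := fun m => by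
    rw [(hLi.pow m).2, hBi.2]
  let Λs : ℕ → AddSubgroup (F × ℝ) := fun m => act d rb⁻¹ (Hs m) (-(ts m)) Λ
  have hΛs : ∀ m, Good C0 (Λs m) := fun m => act_good hd (hHs m) _ hg
  have hrel : ∀ m l, ∀ v ∈ Λs m,
      ((Hs l * Hi m) v.1 - v.2 • (ts l - (Hs l * Hi m) (ts m)), v.2) ∈ Λs l := by
    intro m l v hv
    obtain ⟨u, hu, rfl⟩ := mem_act.1 hv
    refine mem_act.2 ⟨u, hu, ?_⟩
    have e1 : Hi m (Hs m u.1) = u.1 := by rw [← mul_apply_eq_comp, hHiHs]; rfl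
    simp only [mul_apply_eq_comp, map_smul, map_add, map_neg, e1]
    congr 1
    module
  have hfact : ∀ m j, j ≤ m → ∀ z ∈ T0, ∀ σ ∈ S, (Li ^ j) z + Hs m σ ∈ NN d c (Λs m) := by
    intro m j hj z hz σ hσ
    have e1 := hBT _ (Lpow_mem hLT (m - j) z hz)
    have e2 := hN _ (Tinf_Li h1 m (Tinf_of_mem hLT e1)) σ hσ
    have e3 := act_NN (d := d) (hHs m) (-(ts m)) e2
    convert e3 using 1
    have e4 : Hs m ((Li ^ m) (B ((L ^ (m - j)) z) + y0)) = (Li ^ j) z + ts m := by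
      simp only [Hs, ts, mul_apply_eq_comp]
      rw [pow_pow_apply h1, map_add, map_add, ← mul_apply_eq_comp Bi, hBiB, one_apply_eq_self,
        pow_sub_apply h2 (by omega)]
      congr 3
      omega
    rw [map_add, e4]
    abel
  have hfact0 : ∀ m, (0 : F) ∈ NN d c (Λs m) := fun m => by
    have := hfact m 0 (by omega) 0 h0 0 h0S
    simpa using this
  obtain ⟨H, hH, hA1⟩ := claimA1 hd hc hC0 hρ0 hρ hLi hY Λs hΛs hfact0 Hs Hi hHs hHi hHsHi ts
    (b := rb⁻¹ * ‖y0‖) (mul_pos (inv_pos.2 hrb) (norm_pos_iff.2 hy00)) hts hrel hW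
  obtain ⟨η0, hη0, C2, hseq⟩ := hA1 (η / rb) (by positivity)
  choose m l j y g hkj hjm hjl hyY hg1 hgg hHm hHl hlow hupp hrr using hseq
  obtain ⟨y', hy'Y, hy'⟩ := finite_const y hyY
  obtain ⟨s', B', hB', hB'T⟩ := hT y' (hYT y' hy'Y)
  have h0T : (0 : F) ∈ Tinf L T0 := Tinf_of_mem hLT h0
  obtain ⟨Λ', Q, σ', hΛ', hQ, hσ1, hσ2, hσW, hσN⟩ := claimA2 hd hc hρ hL hLi h1 h2 h0T h0S hWS Λs hΛs
    (a := rb⁻¹) Hs hfact m l j y g hkj hjm hjl hg1 hgg hHm hHl hlow hupp hrr hy' hB' hB'T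
  obtain ⟨P, hP, hQP, hPQ⟩ := hQ.exists_inv
  obtain ⟨Hinv, hHinv, hHH, hHH'⟩ := hH.exists_inv
  rw [inv_inv] at hHinv
  set σ0 := Hinv σ' with hσ0
  have hHσ : H σ0 = σ' := by rw [hσ0, ← mul_apply_eq_comp, hHH]; rfl
  have hPQa : ∀ x, P (Q x) = x := fun x => by rw [← mul_apply_eq_comp, hPQ]; rfl
  have hsub : ∀ σ ∈ S, σ - σ0 ∈ S := by
    have hF : Fam d c C0 (Tinf L T0) (S ∪ {x | x + σ0 ∈ S}) := by
      refine ⟨_, P * H, act d s'⁻¹ P 0 Λ', hP.mul hH, act_good hd hP 0 hΛ', ?_⟩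
      rintro x hx σ (hσ | hσ)
      · have := act_NN (d := d) hP 0 (hσN x hx σ hσ).1
        rwa [map_add, hPQa, add_zero] at this
      · have := act_NN (d := d) hP 0 (hσN x hx _ hσ).2
        rwa [map_add, hHσ, ← add_assoc, add_sub_cancel_right, map_add, hPQa, add_zero] at this
    intro σ hσ
    refine hmax _ Set.subset_union_left hF (Or.inr ?_)
    change σ - σ0 + σ0 ∈ S
    rwa [sub_add_cancel]
  have hadd : ∀ σ ∈ S, σ + σ0 ∈ S := by
    have hF : Fam d c C0 (Tinf L T0) {x | x + -σ0 ∈ S} :=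
      Fam_trans hd ⟨1, 1, Λ, Simil.one, hg, hN⟩ _
    intro σ hσ
    refine hmax _ (fun x hx => ?_) hF ?_
    · change x + -σ0 ∈ S
      rw [← sub_eq_add_neg]; exact hsub x hx
    · change σ + σ0 + -σ0 ∈ S
      rwa [add_neg_cancel_right]
  have hn : ‖σ0‖ = rb * ‖σ'‖ := by rw [hσ0, hHinv.2]
  refine ⟨σ0, ?_, ?_, ?_, fun σ hσ => ⟨hadd σ hσ, hsub σ hσ⟩⟩
  · rw [Submodule.mem_orthogonal]
    intro w hw
    have := hσW w hw
    rw [← hHσ, hH.inner_map] at this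
    rcases mul_eq_zero.1 this with h | h
    · exact absurd h (by have := hH.1; positivity)
    · exact h
  · rw [← norm_pos_iff, hn]
    exact mul_pos hrb (by linarith)
  · rw [hn]
    calc rb * ‖σ'‖ ≤ rb * (η / rb) := by gcongr
      _ = η := by field_simp

/-- The core theorem. -/
theorem core {d : ℕ} (hd : Module.finrank ℝ F = d) (hd0 : 1 ≤ d) {c C0 : ℝ} (hc : 0 < c)
    (hC0 : 0 < C0) {L : F →L[ℝ] F} {ρ : ℝ} (hρ : ρ < 1) (hL : Simil ρ L)
    {T0 : Set F} (h0 : (0 : F) ∈ T0) (hLT : ∀ x ∈ T0, L x ∈ T0)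
    (hspan : Submodule.span ℝ T0 = ⊤)
    (hT : ∀ y ∈ T0, ∃ (s : ℝ) (B : F →L[ℝ] F), Simil s B ∧ ∀ x ∈ T0, B x + y ∈ T0)
    {Λ0 : AddSubgroup (F × ℝ)} (hg : Good C0 Λ0) (hN : ∀ x ∈ T0, x ∈ NN d c Λ0) : False := by
  obtain ⟨Li, hLi, h1, h2⟩ := hL.exists_inv
  obtain ⟨Λ1, hΛ1, hN1⟩ := exists_lattice_Tinf hd hc hLi h2 h0 hLT hg hN
  have h0T := Tinf_of_mem hLT h0
  obtain ⟨S, Λ, h0S, hΛ, hNS, hmax⟩ := exists_max hd hc hL hρ hLi h1 h2 h0T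
    (fun n x hx => Tinf_L n hx) (fun n x hx => Tinf_Li h1 n hx) hΛ1 hN1
  exact finish_subgroup hd0 hc h0T h0S hΛ hNS hmax fun W hW hWS η hη =>
    claimA hd hd0 hc hC0 hρ hL hLi h1 h2 h0 hLT hspan hT h0S hΛ hNS hmax W hW hWS η hη

end PartEight

section PartNine
variable {F : Type*} [NormedAddCommGroup F] [InnerProductSpace ℝ F] [FiniteDimensional ℝ F]

theorem simil_of_dist {f : F → F} {s : ℝ} (hs : 0 < s)
    (h : ∀ x y, dist (f x) (f y) = s * dist x y) :
    ∃ O : F →L[ℝ] F, Simil s O ∧ ∀ x, f x = O x + f 0 := by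
  have hi : Isometry (fun x => s⁻¹ • f x) := by
    refine Isometry.of_dist_eq fun x y => ?_
    rw [dist_smul₀, h, norm_inv, Real.norm_of_nonneg hs.le, inv_mul_cancel_left₀ hs.ne']
  let A := hi.affineIsometryOfStrictConvexSpace
  let O : F →L[ℝ] F := s • A.linearIsometry.toContinuousLinearMap
  have hO : ∀ x, O x = s • A.linearIsometry x := fun x => rfl
  refine ⟨O, ⟨hs, fun x => ?_⟩, fun x => ?_⟩
  · rw [hO, norm_smul, Real.norm_of_nonneg hs.le, LinearIsometry.norm_map]
  · have h1 := A.map_vadd 0 x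
    simp only [vadd_eq_add, add_zero] at h1
    have h2 : ∀ y, f y = s • A y := fun y => by
      change f y = s • (s⁻¹ • f y)
      rw [smul_smul, mul_inv_cancel₀ hs.ne', one_smul]
    rw [h2 x, h2 0, h1, hO, smul_add]

theorem dist_foldr {E : Type*} {φ : E → F → F} {r : E → ℝ}
    (hsim : ∀ e, 0 < r e ∧ ∀ x y, dist (φ e x) (φ e y) = r e * dist x y) (w : List E) :
    ∃ s, 0 < s ∧ ∀ x y, dist (w.foldr φ x) (w.foldr φ y) = s * dist x y := by
  induction w with
  | nil => exact ⟨1, one_pos, fun x y => by simp⟩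
  | cons e w ih =>
    obtain ⟨s, hs, h⟩ := ih
    refine ⟨r e * s, mul_pos (hsim e).1 hs, fun x y => ?_⟩
    rw [List.foldr_cons, List.foldr_cons, (hsim e).2, h, mul_assoc]

theorem core2 {E : Type*} {φ : E → F → F} {r : E → ℝ} {d : ℕ} {c C0 : ℝ}
    (hd : Module.finrank ℝ F = d) (hd0 : 1 ≤ d) (hc : 0 < c) (hC0 : 0 < C0)
    (hsim : ∀ e, 0 < r e ∧ ∀ x y, dist (φ e x) (φ e y) = r e * dist x y)
    (hirr : ¬ ∃ L : AffineSubspace ℝ F, (L : Set F).Nonempty ∧ L ≠ ⊤ ∧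
        ∀ e, φ e '' (L : Set F) = (L : Set F))
    {e0 : E} (he0 : r e0 < 1) {z : F} (hz : φ e0 z = z)
    {S : Set F} (hzS : z ∈ S) (hS : ∀ e, ∀ x ∈ S, φ e x ∈ S)
    {Λ : AddSubgroup (F × ℝ)} (hg : Good C0 Λ) (hN : ∀ x ∈ S, x ∈ NN d c Λ) : False := by
  choose O hO hOφ using fun e => simil_of_dist (hsim e).1 (hsim e).2
  have hsub : ∀ e x y, O e (x - y) = φ e x - φ e y := fun e x y => by
    rw [hOφ e x, hOφ e y, map_sub]; abel
  let T : Set F := {x | ∃ w : List E, x = w.foldr φ z}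
  let T0 : Set F := {x | x + z ∈ T}
  have hTφ : ∀ e x, x ∈ T → φ e x ∈ T := by
    rintro e x ⟨w, rfl⟩
    exact ⟨e :: w, rfl⟩
  have hzT : z ∈ T := ⟨[], rfl⟩
  have hTfold : ∀ (w : List E) x, x ∈ T → w.foldr φ x ∈ T := by
    intro w x hx
    induction w with
    | nil => exact hx
    | cons e w ih => exact hTφ e _ ih
  have hTS : T ⊆ S := by
    rintro x ⟨w, rfl⟩
    induction w with
    | nil => exact hzS
    | cons e w ih => exact hS e _ ih
  have h0 : (0:F) ∈ T0 := by change 0 + z ∈ T; rw [zero_add]; exact hzT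
  have hspan : Submodule.span ℝ T0 = ⊤ := by
    set V := Submodule.span ℝ T0 with hV
    have hmap : ∀ e, V.map (O e : F →ₗ[ℝ] F) ≤ V := by
      intro e
      rw [hV, Submodule.map_span, Submodule.span_le]
      rintro _ ⟨x, hx, rfl⟩
      have h1 : φ e (x + z) - z ∈ T0 := by
        change φ e (x + z) - z + z ∈ T
        rw [sub_add_cancel]; exact hTφ e _ hx
      have h2 : φ e z - z ∈ T0 := by
        change φ e z - z + z ∈ T
        rw [sub_add_cancel]; exact hTφ e _ hzT
      have h3 : O e x = (φ e (x + z) - z) - (φ e z - z) := by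
        have := hsub e (x + z) z
        rw [add_sub_cancel_right] at this
        rw [this]; abel
      change O e x ∈ V
      rw [h3]
      exact V.sub_mem (Submodule.subset_span h1) (Submodule.subset_span h2)
    have hmap' : ∀ e, V.map (O e : F →ₗ[ℝ] F) = V := by
      intro e
      obtain ⟨P, hP, h1, h2⟩ := (hO e).exists_inv
      have hinj : Function.Injective (O e : F →ₗ[ℝ] F) := by
        intro x y hxy
        have := congrArg P (show O e x = O e y from hxy)
        rw [← mul_apply_eq_comp, ← mul_apply_eq_comp, h2] at this
        simpa using this
      exact Submodule.eq_of_le_of_finrank_eq (hmap e) 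
        (Submodule.equivMapOfInjective _ hinj V).finrank_eq.symm
    by_contra hne
    apply hirr
    refine ⟨AffineSubspace.mk' z V, ⟨z, AffineSubspace.self_mem_mk' z V⟩, ?_, ?_⟩
    · intro htop
      apply hne
      rw [← AffineSubspace.direction_mk' z V, htop, AffineSubspace.direction_top]
    · intro e
      have hez : φ e z - z ∈ V := Submodule.subset_span (by
        change φ e z - z + z ∈ T
        rw [sub_add_cancel]; exact hTφ e _ hzT)
      ext x
      simp only [Set.mem_image, SetLike.mem_coe, AffineSubspace.mem_mk', vsub_eq_sub]
      constructor
      · rintro ⟨y, hy, rfl⟩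
        have h1 : O e (y - z) ∈ V := hmap e ⟨_, hy, rfl⟩
        rw [hsub] at h1
        have := V.add_mem h1 hez
        rwa [sub_add_sub_cancel] at this
      · intro hx
        have h1 : x - φ e z ∈ V := by
          have := V.sub_mem hx hez
          rwa [sub_sub_sub_cancel_right] at this
        rw [← hmap' e] at h1
        obtain ⟨y, hy, hyx⟩ := h1
        refine ⟨y + z, by rwa [add_sub_cancel_right], ?_⟩
        have := hsub e (y + z) z
        rw [add_sub_cancel_right] at this
        have h4 : O e y = x - φ e z := hyx
        rw [h4] at this
        exact (sub_left_inj.1 this).symm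
  refine core (T0 := T0) (L := O e0) (ρ := r e0) (Λ0 := act d 1 1 (-z) Λ) hd hd0 hc hC0 he0 (hO e0)
    h0 ?_ hspan ?_ (act_good hd Simil.one (-z) hg) ?_
  · intro x hx
    change O e0 x + z ∈ T
    have := hsub e0 (x + z) z
    rw [add_sub_cancel_right] at this
    rw [this, hz, sub_add_cancel]
    exact hTφ e0 _ hx
  · rintro y ⟨w, hw⟩
    obtain ⟨s, hs, hd⟩ := dist_foldr hsim w
    obtain ⟨B, hB, hBw⟩ := simil_of_dist hs hd
    refine ⟨s, B, hB, fun x hx => ?_⟩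
    change B x + y + z ∈ T
    have : B x + y + z = w.foldr φ (x + z) := by
      rw [add_assoc, hw, hBw (x + z), hBw z, map_add]; abel
    rw [this]
    exact hTfold w _ hx
  · intro x hx
    have := act_NN (d := d) (c := c) (Simil.one (F := F)) (-z) (hN _ (hTS hx))
    rwa [one_apply_eq_self, add_neg_cancel_right] at this

end PartNine

section PartTen

theorem exists_G1_span {F : Type*} [NormedAddCommGroup F] [InnerProductSpace ℝ F]
    [FiniteDimensional ℝ F] {ι : Type*} [Fintype ι] (b : Module.Basis ι ℝ (F × ℝ)) :
    ∃ C0 : ℝ, 0 < C0 ∧ G1 C0 (Submodule.span ℤ (Set.range b)).toAddSubgroup := by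
  borelize (F × ℝ)
  let μ : Measure (F × ℝ) := Measure.addHaar
  have hfin : μ (ZSpan.fundamentalDomain b) * 2 ^ Module.finrank ℝ (F × ℝ) < ⊤ :=
    ENNReal.mul_lt_top (ZSpan.fundamentalDomain_isBounded b).measure_lt_top (by finiteness)
  obtain ⟨n, hn⟩ : ∃ n : ℕ, μ (ZSpan.fundamentalDomain b) * 2 ^ Module.finrank ℝ (F × ℝ) <
      μ (Metric.closedBall 0 (n:ℝ)) := by
    by_contra! hcon
    have h1 : μ Set.univ ≤ μ (ZSpan.fundamentalDomain b) * 2 ^ Module.finrank ℝ (F × ℝ) := by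
      rw [← Metric.iUnion_closedBall_nat (0 : F × ℝ), Monotone.measure_iUnion]
      · exact iSup_le hcon
      · intro i j hij
        exact Metric.closedBall_subset_closedBall (by exact_mod_cast hij)
    rw [measure_univ_of_isAddLeftInvariant] at h1
    exact absurd (top_le_iff.1 h1) hfin.ne
  have hn' : μ (Metric.closedBall (0 : F × ℝ) (n:ℝ)) ≤ μ (Metric.closedBall 0 ((n:ℝ) + 1)) :=
    measure_mono (Metric.closedBall_subset_closedBall (by linarith))
  refine ⟨n + 1, by positivity, fun M hM => ?_⟩
  have hdet : LinearMap.det M ≠ 0 := by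
    intro h; rw [h] at hM; simp at hM
  have : Countable (Submodule.span ℤ (Set.range b)).toAddSubgroup :=
    inferInstanceAs (Countable (Submodule.span ℤ (Set.range b)))
  obtain ⟨x, hx0, hx⟩ := exists_ne_zero_mem_lattice_of_measure_mul_two_pow_lt_measure (μ := μ)
    (s := M ⁻¹' (Metric.closedBall 0 ((n:ℝ) + 1))) (ZSpan.isAddFundamentalDomain' b μ)
    (by
      intro x hx
      simp only [Set.mem_preimage, mem_closedBall_zero_iff, map_neg, norm_neg] at hx ⊢
      exact hx)
    ((convex_closedBall _ _).linear_preimage M)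
    (by
      rw [Measure.addHaar_preimage_linearMap μ hdet, abs_inv, hM]
      simpa using hn.trans_le hn')
  refine ⟨x, x.2, ?_, ?_⟩
  · intro h; apply hx0; exact Subtype.ext h
  · simpa using hx

/-- The integer lattice. -/
def Zl (d : ℕ) : AddSubgroup (EuclideanSpace ℝ (Fin d) × ℝ) where
  carrier := {v | (∀ i, ∃ P : ℤ, v.1 i = P) ∧ ∃ Q : ℤ, v.2 = Q}
  zero_mem' := ⟨fun i => ⟨0, by simp⟩, 0, by simp⟩
  add_mem' := by
    rintro v w ⟨h1, Q, hQ⟩ ⟨h2, Q', hQ'⟩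
    refine ⟨fun i => ?_, Q + Q', by simp [hQ, hQ']⟩
    obtain ⟨P, hP⟩ := h1 i
    obtain ⟨P', hP'⟩ := h2 i
    exact ⟨P + P', by simp [hP, hP']⟩
  neg_mem' := by
    rintro v ⟨h1, Q, hQ⟩
    refine ⟨fun i => ?_, -Q, by simp [hQ]⟩
    obtain ⟨P, hP⟩ := h1 i
    exact ⟨-P, by simp [hP]⟩

theorem mem_Zl {d : ℕ} {v : EuclideanSpace ℝ (Fin d) × ℝ} :
    v ∈ Zl d ↔ (∀ i, ∃ P : ℤ, v.1 i = P) ∧ ∃ Q : ℤ, v.2 = Q := Iff.rfl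

theorem exists_G1_Zl (d : ℕ) : ∃ C0 : ℝ, 0 < C0 ∧ G1 C0 (Zl d) := by
  let b := (EuclideanSpace.basisFun (Fin d) ℝ).toBasis.prod (Module.Basis.singleton Unit ℝ)
  obtain ⟨C0, h0, h⟩ := exists_G1_span b
  have hle : Submodule.span ℤ (Set.range b) ≤ (Zl d).toIntSubmodule := by
    rw [Submodule.span_le]
    rintro _ ⟨i, rfl⟩
    change b i ∈ Zl d
    rw [mem_Zl]
    rcases i with i | i
    · refine ⟨fun j => ⟨if j = i then 1 else 0, ?_⟩, 0, ?_⟩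
      · simp [b, PiLp.single_apply]
      · simp [b]
    · refine ⟨fun j => ⟨0, ?_⟩, 1, ?_⟩
      · simp [b]
      · simp [b]
  refine ⟨C0, h0, fun M hM => ?_⟩
  obtain ⟨v, hv, hv'⟩ := h M hM
  exact ⟨v, hle hv, hv'⟩

theorem Zl_lower {d : ℕ} {v : EuclideanSpace ℝ (Fin d) × ℝ} (hv : v ∈ Zl d) (h2 : v.2 = 0)
    (h0 : v ≠ 0) : 1 ≤ ‖v.1‖ := by
  have : ∃ i, v.1 i ≠ 0 := by
    by_contra! hcon
    apply h0
    ext i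
    · simpa using hcon i
    · simpa using h2
  obtain ⟨i, hi⟩ := this
  obtain ⟨P, hP⟩ := hv.1 i
  rw [hP] at hi
  have h1 : (1:ℝ) ≤ |(P:ℝ)| := by
    have : P ≠ 0 := by rintro rfl; exact hi Int.cast_zero
    exact_mod_cast Int.one_le_abs this
  have := PiLp.norm_apply_le v.1 i
  rw [hP, Real.norm_eq_abs] at this
  linarith

theorem BA_subset {d : ℕ} (hd : 1 ≤ d) {α : EuclideanSpace ℝ (Fin d)} {c : ℝ} (hc : 0 < c)
    (h : ∀ q : ℕ, 0 < q → ∀ p : Fin d → ℤ,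
    c * (q : ℝ) ^ (-(1 : ℝ) / d) ≤
      ‖(q : ℝ) • α - (EuclideanSpace.equiv (Fin d) ℝ).symm (fun i => (p i : ℝ))‖) :
    α ∈ NN d (c ^ d) (Zl d) := by
  have key : ∀ (v : EuclideanSpace ℝ (Fin d) × ℝ), v ∈ Zl d → 0 < v.2 →
      c ^ d ≤ |v.2| * ‖v.1 - v.2 • α‖ ^ d := by
    rintro v ⟨hP, Q, hQ⟩ hpos
    choose P hP using hP
    have hQ0 : 0 < Q := by rw [hQ] at hpos; exact_mod_cast hpos
    have hQn : v.2 = (Q.toNat : ℝ) := by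
      rw [hQ]
      have : (Q.toNat : ℤ) = Q := Int.toNat_of_nonneg hQ0.le
      exact_mod_cast this.symm
    have h1 := h Q.toNat (by omega) P
    have h2 : v.1 = (EuclideanSpace.equiv (Fin d) ℝ).symm (fun i => (P i : ℝ)) := by
      ext i; simp [hP]
    rw [← h2, ← hQn, norm_sub_rev] at h1
    have h3 := pow_le_pow_left₀ (by positivity) h1 d
    rw [mul_pow, ← Real.rpow_natCast (v.2 ^ _), ← Real.rpow_mul hpos.le] at h3
    have hd' : (d:ℝ) ≠ 0 := by positivity
    have h4 : -(1:ℝ) / d * (d:ℝ) = -1 := by field_simp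
    rw [h4, Real.rpow_neg_one] at h3
    rw [abs_of_pos hpos]
    calc c ^ d = v.2 * (c ^ d * v.2⁻¹) := by field_simp
      _ ≤ _ := mul_le_mul_of_nonneg_left h3 hpos.le
  intro v hv hv0
  rcases lt_or_gt_of_ne hv0 with h1 | h1
  · have := key (-v) ((Zl d).neg_mem hv) (by simpa using h1)
    simp only [Prod.snd_neg, Prod.fst_neg, abs_neg, neg_smul, sub_neg_eq_add] at this
    rwa [← norm_neg, neg_sub', sub_neg_eq_add]
  · exact key v hv h1

theorem NN_mono {F : Type*} [NormedAddCommGroup F] [InnerProductSpace ℝ F]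
    {d : ℕ} {c c' : ℝ} (h : c' ≤ c) (Λ : AddSubgroup (F × ℝ)) : NN d c Λ ⊆ NN d c' Λ :=
  fun ξ hξ v hv hv0 => h.trans (hξ v hv hv0)

end PartTen

section PartEleven

theorem final_det {E : Type*} {d : ℕ} (hd0 : 1 ≤ d)
    {φ : E → EuclideanSpace ℝ (Fin d) → EuclideanSpace ℝ (Fin d)} {r : E → ℝ}
    (hsim : ∀ e, 0 < r e ∧ ∀ x y, dist (φ e x) (φ e y) = r e * dist x y)
    (hirr : ¬ ∃ L : AffineSubspace ℝ (EuclideanSpace ℝ (Fin d)),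
      (L : Set (EuclideanSpace ℝ (Fin d))).Nonempty ∧ L ≠ ⊤ ∧
        ∀ e, φ e '' (L : Set (EuclideanSpace ℝ (Fin d))) = (L : Set (EuclideanSpace ℝ (Fin d))))
    {e0 : E} (he0 : r e0 < 1) {z : EuclideanSpace ℝ (Fin d)} (hz : φ e0 z = z)
    {S : Set (EuclideanSpace ℝ (Fin d))} (hzS : z ∈ S) (hS : ∀ e, ∀ x ∈ S, φ e x ∈ S)
    {c : ℝ} (hc : 0 < c)
    (ψ : ℕ → EuclideanSpace ℝ (Fin d) → EuclideanSpace ℝ (Fin d)) (s : ℕ → ℝ)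
    (hψ : ∀ k, 0 < s k ∧ ∀ x y, dist (ψ k x) (ψ k y) = s k * dist x y)
    (hs : ∀ k : ℕ, s k ≤ 1 / ((k:ℝ) + 1))
    (hnear : ∀ x ∈ S, ∀ ε > 0, ∀ᶠ k in atTop, ∃ α', ‖α' - x‖ < ε ∧ ψ k α' ∈ NN d c (Zl d)) :
    False := by
  have hfr : Module.finrank ℝ (EuclideanSpace ℝ (Fin d)) = d := by simp
  obtain ⟨C0, hC0, hG1⟩ := exists_G1_Zl d
  choose O hO hOψ using fun k => simil_of_dist (hψ k).1 (hψ k).2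
  choose P hP hOP hPO using fun k => (hO k).exists_inv
  let Λ : ℕ → AddSubgroup (EuclideanSpace ℝ (Fin d) × ℝ) :=
    fun k => act d (s k)⁻¹ (P k) (-(P k (ψ k 0))) (Zl d)
  let 𝒲 : Ultrafilter ℕ := hyperfilter ℕ
  have hle : (𝒲 : Filter ℕ) ≤ atTop := hyperfilter_le_atTop
  have hnear' : ∀ x ∈ S, NearNN d c (𝒲 : Filter ℕ) Λ x := by
    intro x hx ε hε
    refine hle ?_
    filter_upwards [hnear x hx ε hε] with k hk
    obtain ⟨α', h1, h2⟩ := hk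
    refine ⟨α', ?_, h1⟩
    have h3 := act_NN (hP k) (-(P k (ψ k 0))) h2
    have h4 : P k (ψ k α') + -(P k (ψ k 0)) = α' := by
      rw [← sub_eq_add_neg, ← map_sub, hOψ k α', add_sub_cancel_right, ← mul_apply_eq_comp, hPO,
        one_apply_eq_self]
    rwa [h4] at h3
  have hweak : WeakG2 (𝒲 : Filter ℕ) Λ := by
    intro R
    refine hle ?_
    obtain ⟨N, hN⟩ := exists_nat_gt (|R| ^ (d + 1))
    filter_upwards [eventually_ge_atTop N] with k hk w hw hw2 hwR
    obtain ⟨v, hv, rfl⟩ := mem_act.1 hw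
    have hsi := inv_pos.2 (hψ k).1
    have hl := lamOf_pos d hsi
    have hv2 : v.2 = 0 := by
      rcases mul_eq_zero.1 hw2 with h | h
      · exact absurd h hl.ne'
      · exact h
    by_cases hv0 : v = 0
    · subst hv0; simp
    exfalso
    have h1 := Zl_lower hv hv2 hv0
    have h2 : lamOf d (s k)⁻¹ * (s k)⁻¹ ≤ |R| := by
      have h3 := (norm_fst_le _).trans hwR
      simp only [hv2, zero_smul, add_zero] at h3
      rw [norm_smul, Real.norm_of_nonneg hl.le, (hP k).2] at h3
      calc lamOf d (s k)⁻¹ * (s k)⁻¹ ≤ lamOf d (s k)⁻¹ * ((s k)⁻¹ * ‖v.1‖) := by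
            gcongr
            exact le_mul_of_one_le_right hsi.le h1
        _ ≤ R := h3
        _ ≤ |R| := le_abs_self R
    have h3 := pow_le_pow_left₀ (by positivity) h2 (d + 1)
    have h4 : (lamOf d (s k)⁻¹ * (s k)⁻¹) ^ (d + 1) = (s k)⁻¹ := by
      rw [mul_pow, pow_succ (s k)⁻¹, ← mul_assoc, lamOf_spec d hsi, one_mul]
    rw [h4] at h3
    have h5 : (k:ℝ) + 1 ≤ (s k)⁻¹ := by
      have := hs k
      rw [one_div] at this
      exact (le_inv_comm₀ (by positivity) (hψ k).1).2 this
    have h6 : (N:ℝ) ≤ k := by exact_mod_cast hk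
    linarith
  have hgood : Good C0 (Lim (𝒲 : Filter ℕ) Λ) :=
    lim_good hc 𝒲 Λ (fun k => act_G1 hfr (hP k) _ hG1) hweak (hnear' z hzS)
  exact core2 hfr hd0 hc hC0 hsim hirr he0 hz hzS hS hgood
    (fun x hx => lim_NN (𝒲 : Filter ℕ) Λ (hnear' x hx))

end PartEleven

section PartTwelve

/-- Replace the tail of the first sequence after time n by the second one. -/
def glue {E : Type*} (n : ℕ) (b b' : ℕ → E) : ℕ → E := fun i => if i < n then b i else b' (i - n)

theorem seqApply_congr {E X : Type*} (φ : E → X → X) {b b' : ℕ → E} {n : ℕ}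
    (h : ∀ i < n, b i = b' i) : seqApply φ b n = seqApply φ b' n := by
  induction n with
  | zero => rfl
  | succ n ih =>
    funext x
    change seqApply φ b n (φ (b n) x) = seqApply φ b' n (φ (b' n) x)
    rw [ih (fun i hi => h i (by omega)), h n (by omega)]

theorem seqApply_glue {E X : Type*} (φ : E → X → X) (b b' : ℕ → E) (n k : ℕ) (x : X) :
    seqApply φ (glue n b b') (n + k) x = seqApply φ b n (seqApply φ b' k x) := by
  induction k generalizing x with
  | zero =>
    rw [add_zero, seqApply_congr φ (b' := b) (fun i hi => by simp [glue, hi])]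
    rfl
  | succ k ih =>
    change seqApply φ (glue n b b') (n + k) (φ (glue n b b' (n + k)) x) =
      seqApply φ b n (seqApply φ b' k (φ (b' k) x))
    rw [ih]
    simp [glue]

theorem seqApply_dist {E X : Type*} [PseudoMetricSpace X] {φ : E → X → X} {r : E → ℝ}
    (hsim : ∀ e, 0 < r e ∧ ∀ x y, dist (φ e x) (φ e y) = r e * dist x y) (b : ℕ → E) (n : ℕ)
    (x y : X) : dist (seqApply φ b n x) (seqApply φ b n y) =
      (∏ i ∈ Finset.range n, r (b i)) * dist x y := by
  induction n generalizing x y with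
  | zero => simp [seqApply]
  | succ n ih =>
    change dist (seqApply φ b n (φ (b n) x)) (seqApply φ b n (φ (b n) y)) = _
    rw [ih, (hsim _).2, Finset.prod_range_succ, mul_assoc]

variable {E : Type*} [MeasurableSpace E]

theorem measurable_glue (n : ℕ) :
    Measurable (fun p : (ℕ → E) × (ℕ → E) => glue n p.1 p.2) := by
  refine measurable_pi_lambda _ fun i => ?_
  by_cases h : i < n
  · simp only [glue, h, if_true]; fun_prop
  · simp only [glue, h, if_false]; fun_prop

theorem map_glue (μ : Measure E) [IsProbabilityMeasure μ] (n : ℕ) :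
    ((Measure.infinitePi (fun _ : ℕ => μ)).prod (Measure.infinitePi (fun _ : ℕ => μ))).map
      (fun p => glue n p.1 p.2) = Measure.infinitePi (fun _ : ℕ => μ) := by
  refine Measure.eq_infinitePi _ fun s t ht => ?_
  rw [Measure.map_apply (measurable_glue n) (MeasurableSet.pi (Finset.countable_toSet s)
    (fun i _ => ht i))]
  have hset : (fun p : (ℕ → E) × (ℕ → E) => glue n p.1 p.2) ⁻¹' (Set.pi s t) =
      (Set.pi (s.filter (· < n)) t) ×ˢ
      (Set.pi ((s.filter (¬ · < n)).image (· - n)) (fun i => t (i + n))) := by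
    ext p
    simp only [Set.mem_preimage, Set.mem_pi, Finset.mem_coe, Set.mem_prod, Finset.mem_filter,
      Finset.mem_image]
    constructor
    · intro h
      refine ⟨fun i hi => ?_, ?_⟩
      · have := h i hi.1
        simpa [glue, hi.2] using this
      · rintro _ ⟨i, hi, rfl⟩
        have := h i hi.1
        simp only [glue, hi.2, if_false] at this
        rwa [Nat.sub_add_cancel (by omega)]
    · rintro ⟨h1, h2⟩ i hi
      by_cases hin : i < n
      · simpa [glue, hin] using h1 i ⟨hi, hin⟩
      · have := h2 _ ⟨i, ⟨hi, hin⟩, rfl⟩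
        rw [Nat.sub_add_cancel (by omega)] at this
        simpa [glue, hin] using this
  rw [hset, Measure.prod_prod, Measure.infinitePi_pi _ (fun i _ => ht i),
    Measure.infinitePi_pi _ (fun i _ => ht _), Finset.prod_image,
    ← Finset.prod_filter_mul_prod_filter_not s (· < n)]
  · congr 1
    refine Finset.prod_congr rfl fun i hi => ?_
    rw [Nat.sub_add_cancel (by have := (Finset.mem_filter.1 hi).2; omega)]
  · intro i hi j hj hij
    have h1 := (Finset.mem_filter.1 hi).2
    have h2 := (Finset.mem_filter.1 hj).2
    simp only at hij
    omega

theorem glue_approx (μ : Measure E) [IsProbabilityMeasure μ] {A : Set (ℕ → E)}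
    (hA : MeasurableSet A) {ε : ENNReal} (hε : 0 < ε) :
    ∃ n0, ∀ n ≥ n0, ((Measure.infinitePi (fun _ : ℕ => μ)).prod
      (Measure.infinitePi (fun _ : ℕ => μ))) {p | p.1 ∈ A ∧ glue n p.1 p.2 ∉ A} ≤ ε := by
  set β := Measure.infinitePi (fun _ : ℕ => μ) with hβ
  obtain ⟨C, hC, hCA⟩ := exists_measure_symmDiff_lt_of_generateFrom_isSetRing (μ := β)
    (C := measurableCylinders (fun _ : ℕ => E)) isSetRing_measurableCylinders
    ⟨{Set.univ}, Set.countable_singleton _, by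
      simpa using univ_mem_measurableCylinders (fun _ : ℕ => E), by simp⟩
    (generateFrom_measurableCylinders (α := fun _ : ℕ => E)).symm hA (ENNReal.half_pos hε.ne')
  have hCm : MeasurableSet C := MeasurableSet.of_mem_measurableCylinders hC
  obtain ⟨s, S, hS, rfl⟩ := (mem_measurableCylinders _).1 hC
  refine ⟨s.sup id + 1, fun n hn => ?_⟩
  have hglue : ∀ b b' : ℕ → E, b ∈ cylinder s S → glue n b b' ∈ cylinder s S := by
    intro b b' hb
    rw [mem_cylinder] at hb ⊢
    convert hb using 1
    funext i
    have : (i:ℕ) ≤ s.sup id := Finset.le_sup (f := id) i.2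
    simp [Finset.restrict, glue, show (i:ℕ) < n by omega]
  have hsub : {p : (ℕ → E) × (ℕ → E) | p.1 ∈ A ∧ glue n p.1 p.2 ∉ A} ⊆
      ((A \ cylinder s S) ×ˢ Set.univ) ∪
        (fun p : (ℕ → E) × (ℕ → E) => glue n p.1 p.2) ⁻¹' (cylinder s S \ A) := by
    rintro ⟨b, b'⟩ ⟨h1, h2⟩
    by_cases hb : b ∈ cylinder s S
    · right; exact ⟨hglue _ _ hb, h2⟩
    · left; exact ⟨⟨h1, hb⟩, trivial⟩
  calc (β.prod β) {p | p.1 ∈ A ∧ glue n p.1 p.2 ∉ A}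
      ≤ (β.prod β) ((A \ cylinder s S) ×ˢ Set.univ) +
        (β.prod β) ((fun p : (ℕ → E) × (ℕ → E) => glue n p.1 p.2) ⁻¹' (cylinder s S \ A)) :=
        (measure_mono hsub).trans (measure_union_le _ _)
    _ = β (A \ cylinder s S) + β (cylinder s S \ A) := by
        rw [Measure.prod_prod, measure_univ, mul_one,
          ← Measure.map_apply (measurable_glue n) (hCm.diff hA), map_glue]
    _ ≤ ε / 2 + ε / 2 := by
        refine add_le_add ((measure_mono ?_).trans hCA.le) ((measure_mono ?_).trans hCA.le)
        · exact fun x hx => Or.inr hx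
        · exact fun x hx => Or.inl hx
    _ = ε := ENNReal.add_halves ε

theorem ratio_tendsto (μ : Measure E) [IsProbabilityMeasure μ] {r : E → ℝ} (hr0 : ∀ e, 0 < r e)
    (hrm : Measurable r) (hInt : Integrable (fun e => Real.log (r e)) μ)
    (havg : ∫ e, Real.log (r e) ∂μ < 0) :
    ∀ᵐ b ∂(Measure.infinitePi (fun _ : ℕ => μ)),
      Tendsto (fun n => ∏ i ∈ Finset.range n, r (b i)) atTop (𝓝 0) := by
  set β := Measure.infinitePi (fun _ : ℕ => μ) with hβ
  have hlm : Measurable (fun e => Real.log (r e)) := Real.measurable_log.comp hrm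
  have hmp : ∀ i : ℕ, MeasurePreserving (Function.eval i) β μ := fun i =>
    measurePreserving_eval_infinitePi (fun _ : ℕ => μ) i
  have h := ProbabilityTheory.strong_law_ae_real (μ := β) (fun i b => Real.log (r (b i)))
    ((hmp 0).integrable_comp_of_integrable hInt)
    (fun i j hij => (ProbabilityTheory.iIndepFun_infinitePi (P := fun _ : ℕ => μ)
      (X := fun _ e => Real.log (r e)) (fun _ => hlm)).indepFun hij)
    (fun i => by
      refine ⟨(hlm.comp (measurable_pi_apply i)).aemeasurable,
        (hlm.comp (measurable_pi_apply 0)).aemeasurable, ?_⟩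
      have h1 := fun i => (Measure.map_map (μ := β) hlm (measurable_pi_apply i))
      have h2 := (hmp i).map_eq
      have h3 := (hmp 0).map_eq
      change Measure.map ((fun e => Real.log (r e)) ∘ Function.eval i) β =
        Measure.map ((fun e => Real.log (r e)) ∘ Function.eval 0) β
      rw [← Measure.map_map hlm (hmp i).measurable, ← Measure.map_map hlm (hmp 0).measurable,
        h2, h3])
  have hmean : ∫ b, Real.log (r (b 0)) ∂β = ∫ e, Real.log (r e) ∂μ := by
    rw [← (hmp 0).map_eq, integral_map (hmp 0).measurable.aemeasurable
      hlm.aestronglyMeasurable]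
  rw [hmean] at h
  filter_upwards [h] with b hb
  have h1 : Tendsto (fun n : ℕ => ∑ i ∈ Finset.range n, Real.log (r (b i))) atTop atBot := by
    have h2 := hb.neg_mul_atTop havg tendsto_natCast_atTop_atTop
    refine h2.congr' ?_
    filter_upwards [eventually_gt_atTop 0] with n hn
    have : (n:ℝ) ≠ 0 := by positivity
    field_simp
  have h3 := Real.tendsto_exp_atBot.comp h1
  refine h3.congr fun n => ?_
  simp only [Function.comp]
  rw [Real.exp_sum]
  exact Finset.prod_congr rfl fun i _ => Real.exp_log (hr0 _)

theorem exists_good_time (μ : Measure E) [IsProbabilityMeasure μ] {r : E → ℝ} (hr0 : ∀ e, 0 < r e)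
    (hrm : Measurable r) (hInt : Integrable (fun e => Real.log (r e)) μ)
    (havg : ∫ e, Real.log (r e) ∂μ < 0) {A : Set (ℕ → E)} (hA : MeasurableSet A)
    (hpos : 0 < Measure.infinitePi (fun _ : ℕ => μ) A) {δ : ℝ} (hδ : 0 < δ) {η : ENNReal}
    (hη : 0 < η) (hηtop : η ≠ ⊤) :
    ∃ n, ∃ b ∈ A, ∏ i ∈ Finset.range n, r (b i) ≤ δ ∧
      Measure.infinitePi (fun _ : ℕ => μ) {b' | glue n b b' ∉ A} ≤ η := by
  set β := Measure.infinitePi (fun _ : ℕ => μ) with hβ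
  have hβA : β A ≠ ⊤ := measure_ne_top _ _
  have hq : 0 < β A / 2 := ENNReal.half_pos hpos.ne'
  have hmeas : ∀ n, Measurable (fun b : ℕ → E => ∏ i ∈ Finset.range n, r (b i)) := fun n =>
    Finset.measurable_prod _ fun i _ => hrm.comp (measurable_pi_apply i)
  have htm : TendstoInMeasure β (fun n (b : ℕ → E) => ∏ i ∈ Finset.range n, r (b i)) atTop
      (fun _ => (0:ℝ)) :=
    tendstoInMeasure_of_tendsto_ae (fun n => (hmeas n).aestronglyMeasurable)
      (ratio_tendsto μ hr0 hrm hInt havg)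
  rw [tendstoInMeasure_iff_norm] at htm
  have h1 := (htm δ hδ).eventually (gt_mem_nhds hq)
  have hε : 0 < η * (β A / 2) / 2 := ENNReal.half_pos (ENNReal.mul_pos hη.ne' hq.ne').ne'
  obtain ⟨n0, hn0⟩ := glue_approx μ hA hε
  obtain ⟨n, hn, hnn0⟩ := (h1.and (eventually_ge_atTop n0)).exists
  refine ⟨n, ?_⟩
  by_contra! hcon
  have hB : MeasurableSet {p : (ℕ → E) × (ℕ → E) | p.1 ∈ A ∧ glue n p.1 p.2 ∉ A} :=
    (measurable_fst hA).inter ((measurable_glue n) hA).compl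
  have h2 := hn0 n hnn0
  rw [Measure.prod_apply hB] at h2
  have h3 := mul_meas_ge_le_lintegral (μ := β) (measurable_measure_prodMk_left (ν := β) hB) η
  set D := {b : ℕ → E | η ≤ β (Prod.mk b ⁻¹' {p | p.1 ∈ A ∧ glue n p.1 p.2 ∉ A})} with hD
  have hAsub : A ⊆ D ∪ {b | δ ≤ ‖∏ i ∈ Finset.range n, r (b i) - 0‖} := by
    intro b hb
    by_cases hbr : ∏ i ∈ Finset.range n, r (b i) ≤ δ
    · left
      refine (hcon b hb hbr).le.trans (measure_mono ?_)
      intro b' hb'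
      exact ⟨hb, hb'⟩
    · right
      rw [Set.mem_ofPred_eq, sub_zero]
      exact (not_le.1 hbr).le.trans (le_abs_self _)
  have h4 : β A ≤ β D + β {b | δ ≤ ‖∏ i ∈ Finset.range n, r (b i) - 0‖} :=
    (measure_mono hAsub).trans (measure_union_le _ _)
  have h5 : β A / 2 ≤ β D := by
    by_contra! hlt
    have : β A < β A / 2 + β A / 2 := h4.trans_lt (ENNReal.add_lt_add hlt hn)
    rw [ENNReal.add_halves] at this
    exact lt_irrefl _ this
  have h6 : η * (β A / 2) ≤ η * (β A / 2) / 2 :=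
    (mul_le_mul_right h5 η).trans (h3.trans h2)
  have h7 : η * (β A / 2) / 2 < η * (β A / 2) :=
    ENNReal.half_lt_self (ENNReal.mul_pos hη.ne' hq.ne').ne' (ENNReal.mul_ne_top hηtop
      (ENNReal.div_ne_top hβA (by simp)))
  exact absurd h6 (not_le.2 h7)

end PartTwelve

section PartThirteen

theorem continuous_seqApply {E X : Type*} [TopologicalSpace E] [TopologicalSpace X]
    {φ : E → X → X} (hcont : Continuous fun p : E × X => φ p.1 p.2) (n : ℕ) :
    Continuous (fun p : (ℕ → E) × X => seqApply φ p.1 n p.2) := by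
  induction n with
  | zero => exact continuous_snd
  | succ n ih =>
    have h0 : Continuous (fun p : (ℕ → E) × X => (p.1 n, p.2)) := by fun_prop
    have h2 : Continuous (fun p : (ℕ → E) × X => φ (p.1 n) p.2) := hcont.comp h0
    have h1 : Continuous (fun p : (ℕ → E) × X => (p.1, φ (p.1 n) p.2)) :=
      continuous_fst.prodMk h2
    exact ih.comp h1

theorem tendsto_glue {E X : Type*} [TopologicalSpace E] [TopologicalSpace X]
    {φ : E → X → X} (hcont : Continuous fun p : E × X => φ p.1 p.2) (n : ℕ) (b b' : ℕ → E)
    {x0 α : X} (h : Tendsto (fun k => seqApply φ b' k x0) atTop (𝓝 α)) :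
    Tendsto (fun k => seqApply φ (glue n b b') k x0) atTop (𝓝 (seqApply φ b n α)) := by
  rw [← tendsto_add_atTop_iff_nat n]
  have h1 : Continuous (fun x => seqApply φ b n x) :=
    (continuous_seqApply hcont n).comp (by fun_prop : Continuous fun x : X => (b, x))
  refine ((h1.tendsto α).comp h).congr fun k => ?_
  rw [add_comm k n, seqApply_glue]
  rfl

theorem main_aux
    (d : ℕ) (hd : 1 ≤ d) {E : Type*} [MetricSpace E] [CompactSpace E] [Nonempty E]
    [MeasurableSpace E] [BorelSpace E]
    (φ : E → EuclideanSpace ℝ (Fin d) → EuclideanSpace ℝ (Fin d))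
    (r : E → ℝ)
    (hsim : ∀ e, 0 < r e ∧ ∀ x y, dist (φ e x) (φ e y) = r e * dist x y)
    (hcont : Continuous fun p : E × EuclideanSpace ℝ (Fin d) => φ p.1 p.2)
    (hrcont : Continuous r)
    (hirr : IrreducibleIFS φ)
    (μ : Measure E) [IsProbabilityMeasure μ]
    (hsupp : ∀ U : Set E, IsOpen U → U.Nonempty → μ U ≠ 0)
    (havg : ∫ e, Real.log (r e) ∂μ < 0) {c : ℝ} (hc : 0 < c) :
    Measure.infinitePi (fun _ : ℕ => μ) {b : ℕ → E | ∃ α ∈ NN d c (Zl d),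
        Tendsto (fun n => seqApply φ b n 0) atTop (𝓝 α)} = 0 := by
  set β := Measure.infinitePi (fun _ : ℕ => μ) with hβ
  set A := {b : ℕ → E | ∃ α ∈ NN d c (Zl d),
        Tendsto (fun n => seqApply φ b n 0) atTop (𝓝 α)} with hAdef
  by_contra hA0
  have : SecondCountableTopology E := inferInstance
  have hum : ∀ n, Measurable (fun b : ℕ → E => seqApply φ b n 0) := fun n =>
    ((continuous_seqApply hcont n).comp
      (by fun_prop : Continuous fun b : ℕ → E =>
        (b, (0 : EuclideanSpace ℝ (Fin d))))).measurable
  have hAne : A.Nonempty := by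
    rw [Set.nonempty_iff_ne_empty]; intro h; exact hA0 (by rw [h, measure_empty])
  have hNNne : (NN d c (Zl d)).Nonempty := by
    obtain ⟨b, α, h, -⟩ := hAne; exact ⟨α, h⟩
  have hA : MeasurableSet A := by
    have h1 : A = {b | ∃ α, Tendsto (fun n => seqApply φ b n 0) atTop (𝓝 α)} ∩
        {b | Tendsto (fun n => Metric.infDist (seqApply φ b n 0) (NN d c (Zl d))) atTop
          (𝓝 0)} := by
      ext b
      constructor
      · rintro ⟨α, hα, ht⟩
        refine ⟨⟨α, ht⟩, ?_⟩
        have := ((Metric.continuous_infDist_pt (NN d c (Zl d))).tendsto α).comp ht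
        rw [Metric.infDist_zero_of_mem hα] at this
        exact this
      · rintro ⟨⟨α, ht⟩, h0⟩
        refine ⟨α, ?_, ht⟩
        have := ((Metric.continuous_infDist_pt (NN d c (Zl d))).tendsto α).comp ht
        have h2 := tendsto_nhds_unique this h0
        exact ((isClosed_NN d c (Zl d)).mem_iff_infDist_zero hNNne).2 h2
    rw [h1]
    exact (measurableSet_exists_tendsto hum).inter (measurableSet_tendsto (𝓝 0) (fun n =>
      (Metric.continuous_infDist_pt (NN d c (Zl d))).measurable.comp (hum n)))
  have hlogc : Continuous fun e => Real.log (r e) := hrcont.log (fun e => (hsim e).1.ne')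
  have hInt : Integrable (fun e => Real.log (r e)) μ :=
    hlogc.integrable_of_hasCompactSupport (HasCompactSupport.of_compactSpace _)
  -- the contracting element
  obtain ⟨e0, he0⟩ : ∃ e0, r e0 < 1 := by
    by_contra! hcon
    exact absurd havg (not_lt.2 (integral_nonneg fun e => Real.log_nonneg (hcon e)))
  have hcontr : ContractingWith (⟨r e0, (hsim e0).1.le⟩ : NNReal) (φ e0) := by
    refine ⟨by exact_mod_cast he0, LipschitzWith.of_dist_le_mul fun x y => ?_⟩
    exact ((hsim e0).2 x y).le
  set z := ContractingWith.fixedPoint (φ e0) hcontr with hzdef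
  have hz : φ e0 z = z := hcontr.fixedPoint_isFixedPt
  -- the support
  let W : EuclideanSpace ℝ (Fin d) → ℝ → Set (ℕ → E) := fun x ε =>
    {b | ∃ α, Tendsto (fun n => seqApply φ b n 0) atTop (𝓝 α) ∧ ‖α - x‖ < ε}
  let S : Set (EuclideanSpace ℝ (Fin d)) := {x | ∀ ε > 0, β (W x ε) ≠ 0}
  have hSne : S.Nonempty := by
    by_contra hcon
    rw [Set.not_nonempty_iff_eq_empty, Set.eq_empty_iff_forall_notMem] at hcon
    have h1 : ∀ x, ∃ ε > 0, β (W x ε) = 0 := by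
      intro x
      have := hcon x
      simp only [S, Set.mem_ofPred_eq] at this
      push Not at this
      exact this
    choose ε hε hW using h1
    obtain ⟨s, hs, hcov⟩ := TopologicalSpace.countable_cover_nhds
      (f := fun x => Metric.ball x (ε x)) (fun x => Metric.ball_mem_nhds x (hε x))
    apply hA0
    refine measure_mono_null ?_ ((measure_biUnion_null_iff hs).2 (fun x _ => hW x))
    rintro b ⟨α, -, ht⟩
    have : α ∈ ⋃ x ∈ s, Metric.ball x (ε x) := by rw [hcov]; trivial
    simp only [Set.mem_iUnion] at this ⊢
    obtain ⟨x, hx, hxα⟩ := this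
    exact ⟨x, hx, α, ht, by rwa [← dist_eq_norm]⟩
  have hSφ : ∀ e, ∀ x ∈ S, φ e x ∈ S := by
    intro e x hx ε hε
    have h1 : ∀ᶠ p : E × EuclideanSpace ℝ (Fin d) in 𝓝 (e, x),
        dist (φ p.1 p.2) (φ e x) < ε :=
      (hcont.tendsto (e, x)).eventually (Metric.ball_mem_nhds _ hε)
    rw [nhds_prod_eq] at h1
    obtain ⟨p1, hp1, p2, hp2, hp⟩ := Filter.eventually_prod_iff.1 h1
    obtain ⟨U, hU, hUo, heU⟩ := mem_nhds_iff.1 hp1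
    obtain ⟨δ, hδ, hball⟩ := Metric.mem_nhds_iff.1 hp2
    have hsub : ((Function.eval 0) ⁻¹' U) ×ˢ W x δ ⊆
        (fun p : (ℕ → E) × (ℕ → E) => glue 1 p.1 p.2) ⁻¹' (W (φ e x) ε) := by
      rintro ⟨b, b'⟩ ⟨hb, α, ht, hα⟩
      refine ⟨seqApply φ b 1 α, tendsto_glue hcont 1 b b' ht, ?_⟩
      change ‖φ (b 0) α - φ e x‖ < ε
      rw [← dist_eq_norm]
      exact hp (hU hb) (hball (by rw [Metric.mem_ball, dist_eq_norm]; exact hα))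
    have hV : β ((Function.eval 0) ⁻¹' U) ≠ 0 := by
      rw [(measurePreserving_eval_infinitePi (fun _ : ℕ => μ) 0).measure_preimage
        hUo.measurableSet.nullMeasurableSet]
      exact hsupp U hUo ⟨e, heU⟩
    intro h0
    have h2 : (β.prod β) (((Function.eval 0) ⁻¹' U) ×ˢ W x δ) ≤ β (W (φ e x) ε) := by
      refine (measure_mono hsub).trans ?_
      conv_rhs => rw [hβ, ← map_glue μ 1]
      exact Measure.le_map_apply (measurable_glue 1).aemeasurable _
    rw [h0, Measure.prod_prod] at h2
    rcases mul_eq_zero.1 (le_antisymm h2 bot_le) with h | h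
    · exact hV h
    · exact hx δ hδ h
  have hzS : z ∈ S := by
    obtain ⟨x0, hx0⟩ := hSne
    intro ε hε
    have h1 := hcontr.tendsto_iterate_fixedPoint x0
    obtain ⟨n, hn⟩ := ((Metric.tendsto_nhds.1 h1) (ε / 2) (half_pos hε)).exists
    have h2 : (φ e0)^[n] x0 ∈ S := by
      clear hn
      induction n with
      | zero => exact hx0
      | succ n ih => rw [Function.iterate_succ_apply']; exact hSφ e0 _ ih
    intro h0
    refine h2 (ε / 2) (half_pos hε) (measure_mono_null ?_ h0)
    rintro b ⟨α, ht, hα⟩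
    refine ⟨α, ht, ?_⟩
    rw [dist_eq_norm] at hn
    calc ‖α - z‖ = ‖(α - (φ e0)^[n] x0) + ((φ e0)^[n] x0 - z)‖ := by rw [sub_add_sub_cancel]
      _ ≤ _ := norm_add_le _ _
      _ < ε := by linarith
  have hpos : 0 < β A := pos_iff_ne_zero.2 hA0
  have htimes := fun k : ℕ => exists_good_time μ (fun e => (hsim e).1) hrcont.measurable hInt havg
    hA hpos (δ := 1 / ((k:ℝ) + 1)) (by positivity) (η := ((k:ENNReal))⁻¹ ⊓ 1)
    (by
      refine lt_min ?_ one_pos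
      exact ENNReal.inv_pos.2 (ENNReal.natCast_ne_top k))
    (ne_top_of_le_ne_top ENNReal.one_ne_top inf_le_right)
  choose n b hbA hr hglue using htimes
  refine final_det hd hsim hirr he0 hz hzS hSφ hc (fun k => seqApply φ (b k) (n k))
    (fun k => ∏ i ∈ Finset.range (n k), r (b k i))
    (fun k => ⟨Finset.prod_pos fun i _ => (hsim _).1, seqApply_dist hsim _ _⟩) hr ?_
  intro x hx ε hε
  have hWpos : 0 < β (W x ε) := pos_iff_ne_zero.2 (hx ε hε)
  filter_upwards [ENNReal.tendsto_inv_nat_nhds_zero.eventually (gt_mem_nhds hWpos)] with k hk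
  have hns : ¬ W x ε ⊆ {b' | glue (n k) (b k) b' ∉ A} := by
    intro hsub
    have := (measure_mono hsub).trans ((hglue k).trans inf_le_left)
    exact absurd hk (not_lt.2 this)
  obtain ⟨b', ⟨α', ht, hα'⟩, hb'⟩ := Set.not_subset.1 hns
  refine ⟨α', hα', ?_⟩
  have hb'' : glue (n k) (b k) b' ∈ A := not_not.1 hb'
  obtain ⟨α, hα, ht'⟩ := hb''
  have := tendsto_nhds_unique ht' (tendsto_glue hcont (n k) (b k) b' ht)
  rwa [this] at hα

end PartThirteen

/-- **Theorem.** Let `Φ = (φ_e)_{e ∈ E}` be an irreducible compact similarity IFS on `ℝ^d`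
(each `φ_e` is a similarity with scaling ratio `r e`, depending continuously on `e ∈ E`,
`E` a compact metric space), and let `μ` be a Borel probability measure on `E` with full
support which is contracting on average, i.e. `∫ log (r e) dμ(e) < 0`.  Then, with
`β = μ^{⊗ℕ}`, the set of `b ∈ E^ℕ` such that the coding-map limit `π(b)` exists and is
badly approximable has `β`-measure zero. -/
theorem bernoulli_compact_IFS_badlyApproximable_eq_zero
    (d : ℕ) (hd : 1 ≤ d) {E : Type*} [MetricSpace E] [CompactSpace E] [Nonempty E]
    [MeasurableSpace E] [BorelSpace E]
    (φ : E → EuclideanSpace ℝ (Fin d) → EuclideanSpace ℝ (Fin d))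
    (r : E → ℝ)
    (hsim : ∀ e, 0 < r e ∧ ∀ x y, dist (φ e x) (φ e y) = r e * dist x y)
    (hcont : Continuous fun p : E × EuclideanSpace ℝ (Fin d) => φ p.1 p.2)
    (hrcont : Continuous r)
    (hirr : IrreducibleIFS φ)
    (μ : Measure E) [IsProbabilityMeasure μ]
    (hsupp : ∀ U : Set E, IsOpen U → U.Nonempty → μ U ≠ 0)
    (havg : ∫ e, Real.log (r e) ∂μ < 0)
    (β : Measure (ℕ → E)) (hβ : IsBernoulli μ β) :
    β {b : ℕ → E | ∃ α ∈ badlyApproximable d,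
        Tendsto (fun n => seqApply φ b n 0) atTop (𝓝 α)} = 0 := by
  have hβ' : β = Measure.infinitePi (fun _ : ℕ => μ) :=
    Measure.eq_infinitePi _ (fun s t ht => hβ.2 s t (fun i _ => ht i))
  rw [hβ']
  refine measure_mono_null ?_ (measure_iUnion_null fun m : ℕ =>
    main_aux d hd φ r hsim hcont hrcont hirr μ hsupp havg (c := 1 / ((m:ℝ) + 1)) (by positivity))
  rintro b ⟨α, ⟨c, hc, h⟩, ht⟩
  obtain ⟨m, hm⟩ := exists_nat_one_div_lt (pow_pos hc d)
  exact Set.mem_iUnion.2 ⟨m, α, NN_mono hm.le _ (BA_subset hd hc h), ht⟩
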